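/- arXiv:1410.7170 — 7 statements merged into one kernel-verified Lean document; each statement's English description precedes it below -/
import Mathlib

section
/- Let n be a positive integer, B, C ∈ ℂ^{n×n}, m ∈ ℂ, and let A ∈ ℂ^{2n×2n} be the block matrix with diagonal blocks mI_n and off-diagonal blocks B (top right) and C (bottom left), i.e. A = [[mI, B],[C, mI]]. Then the spectrum of A is symmetric about m: if λ is an eigenvalue of A, then 2m − λ is an eigenvalue of A. -/
open Matrix

/-- the spectrum of the block matrix `A = [[m•I, B], [C, m•I]]` is
symmetric about `m`: if `λ` is an eigenvalue of `A`, then so is `2m - λ`. -/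
theorem spectrum_symmetric_of_two_cyclic_block {n : ℕ} (hn : 0 < n)
    (B C : Matrix (Fin n) (Fin n) ℂ) (m : ℂ)
    (lam : ℂ)
    (hlam : lam ∈ spectrum ℂ (Matrix.fromBlocks (m • (1 : Matrix (Fin n) (Fin n) ℂ)) B
      C (m • (1 : Matrix (Fin n) (Fin n) ℂ)))) :
    2 * m - lam ∈ spectrum ℂ (Matrix.fromBlocks (m • (1 : Matrix (Fin n) (Fin n) ℂ)) B
      C (m • (1 : Matrix (Fin n) (Fin n) ℂ))) := by
  rw [spectrum.mem_iff] at hlam ⊢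
  intro h
  apply hlam
  have hS : (Matrix.fromBlocks 1 0 0 (-1) : Matrix (Fin n ⊕ Fin n) (Fin n ⊕ Fin n) ℂ) *
      Matrix.fromBlocks 1 0 0 (-1) = 1 := by
    simp [Matrix.fromBlocks_multiply]
  have hU : IsUnit (Matrix.fromBlocks 1 0 0 (-1) :
      Matrix (Fin n ⊕ Fin n) (Fin n ⊕ Fin n) ℂ) := IsUnit.of_mul_eq_one _ hS
  have key := ((hU.mul h).mul hU).neg
  convert key using 1
  have e : ∀ c : ℂ, algebraMap ℂ (Matrix (Fin n ⊕ Fin n) (Fin n ⊕ Fin n) ℂ) c =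
      Matrix.fromBlocks (c • 1) 0 0 (c • 1) := by
    intro c
    rw [Algebra.algebraMap_eq_smul_one, ← Matrix.fromBlocks_one, Matrix.fromBlocks_smul]
    simp
  rw [e, e, sub_eq_add_neg, sub_eq_add_neg, Matrix.fromBlocks_neg, Matrix.fromBlocks_add,
    Matrix.fromBlocks_add, Matrix.fromBlocks_multiply, Matrix.fromBlocks_multiply,
    Matrix.fromBlocks_neg]
  congr 1
  · simp only [Matrix.one_mul, Matrix.mul_one, Matrix.zero_mul, Matrix.mul_zero, add_zero]
    module
  · simp
  · simp
  · simp only [Matrix.neg_mul, Matrix.mul_neg, Matrix.one_mul, Matrix.mul_one, Matrix.zero_mul,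
      Matrix.mul_zero, zero_add]
    module
end

section
/- Let Γ ∈ ℂ^{n×n} be hermitian and unitary, let a ∈ ℝ, a ≠ 0, and let D ∈ ℂ^{n×n} satisfy the Γ₅-symmetry (ΓD)^H = ΓD and the Ginsparg–Wilson relation ΓD + DΓ = a·DΓD. Then the matrix S := Γ(aD − I) satisfies S^H = S and S² = I. -/
open Matrix

/-- if `Γ` is hermitian and unitary and `D` is `Γ₅`-symmetric and satisfies the
Ginsparg–Wilson relation `ΓD + DΓ = a·DΓD`, then `S = Γ(aD - I)` is hermitian and involutory. -/
theorem gamma5_GW_gives_involution {n : ℕ} (hn : 0 < n)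
    (Γ D : Matrix (Fin n) (Fin n) ℂ)
    (hΓH : Γᴴ = Γ) (hΓ2 : Γ * Γ = 1)
    (a : ℝ) (ha : a ≠ 0)
    (hD : (Γ * D)ᴴ = Γ * D)
    (hGW : Γ * D + D * Γ = (a : ℂ) • (D * Γ * D)) :
    (Γ * ((a : ℂ) • D - 1))ᴴ = Γ * ((a : ℂ) • D - 1) ∧
    (Γ * ((a : ℂ) • D - 1)) * (Γ * ((a : ℂ) • D - 1)) = 1 := by
  have h1 : Γ * ((a : ℂ) • D - 1) = (a : ℂ) • (Γ * D) - Γ := by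
    rw [mul_sub, mul_one, mul_smul_comm]
  constructor
  · rw [h1, conjTranspose_sub, conjTranspose_smul, hD, hΓH]
    simp
  · have h2 : ((a : ℂ) • D - 1) * (Γ * ((a : ℂ) • D - 1)) = Γ := by
      have h3 : ((a : ℂ) • D - 1) * (Γ * ((a : ℂ) • D - 1))
          = (a : ℂ) • ((a : ℂ) • (D * Γ * D)) - (a : ℂ) • (Γ * D + D * Γ) + Γ := by
        rw [h1, sub_mul, mul_sub, one_mul, smul_mul_assoc, mul_smul_comm, smul_mul_assoc,
          mul_assoc, smul_add]
        abel
      rw [h3, hGW, sub_self, zero_add]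
    rw [mul_assoc, h2, hΓ2]
end

section
/- Let Γ ∈ ℂ^{n×n} be hermitian and unitary, let a ∈ ℝ, a ≠ 0, and let S ∈ ℂ^{n×n} satisfy S^H = S and S² = I. Then the matrix D := (1/a)(I + ΓS) is Γ₅-symmetric, (ΓD)^H = ΓD, and satisfies the Ginsparg–Wilson relation ΓD + DΓ = a·DΓD. -/
open Matrix

/-- if `Γ` is hermitian and unitary and `S` is hermitian with `S² = I`, then
`D = (1/a)(I + ΓS)` is `Γ₅`-symmetric and satisfies the Ginsparg–Wilson relation. -/
theorem involution_gives_gamma5_GW {n : ℕ} (hn : 0 < n)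
    (Γ S : Matrix (Fin n) (Fin n) ℂ)
    (hΓH : Γᴴ = Γ) (hΓ2 : Γ * Γ = 1)
    (a : ℝ) (ha : a ≠ 0)
    (hSH : Sᴴ = S) (hS2 : S * S = 1) :
    (Γ * ((1 / (a : ℂ)) • (1 + Γ * S)))ᴴ = Γ * ((1 / (a : ℂ)) • (1 + Γ * S)) ∧
    Γ * ((1 / (a : ℂ)) • (1 + Γ * S)) + ((1 / (a : ℂ)) • (1 + Γ * S)) * Γ =
      (a : ℂ) • (((1 / (a : ℂ)) • (1 + Γ * S)) * Γ * ((1 / (a : ℂ)) • (1 + Γ * S))) := by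
  have ha' : (a : ℂ) ≠ 0 := by exact_mod_cast ha
  have h1 : Γ * (1 + Γ * S) = Γ + S := by
    rw [mul_add, mul_one, ← mul_assoc, hΓ2, one_mul]
  have h2 : (1 + Γ * S) * (Γ + S) = Γ + S + (1 + Γ * S) * Γ := by
    have h3 : Γ * S * S = Γ := by rw [mul_assoc, hS2, mul_one]
    rw [mul_add, add_mul, add_mul, one_mul, one_mul, h3]
    abel
  constructor
  · rw [mul_smul_comm, h1, conjTranspose_smul, conjTranspose_add, hΓH, hSH]
    simp
  · rw [mul_assoc, mul_smul_comm, h1, smul_mul_assoc, smul_mul_assoc, mul_smul_comm, h2,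
      smul_smul, mul_one_div_cancel ha', one_smul, ← smul_add]
end

section
/- Let Γ ∈ ℂ^{n×n} be hermitian and unitary, let D ∈ ℂ^{n×n} be such that ΓD is hermitian, and let ΓD = WΔW^H be an eigendecomposition with W unitary and Δ real diagonal and invertible. Then U := Γ·W·sign(Δ) is unitary (where sign is applied entrywise to the diagonal of Δ), and D = U·|Δ|·W^H; that is, (U, |Δ|, W) is a singular value decomposition of D with singular values the absolute values of the diagonal entries of Δ. -/
open Matrix

/-- if `ΓD` is hermitian with eigendecomposition `ΓD = WΔWᴴ` (`Δ` real diagonal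
invertible), then `U = Γ·W·sign(Δ)` is unitary and `D = U·|Δ|·Wᴴ` is a singular value
decomposition of `D`. -/
theorem svd_of_gamma5_symmetric {n : ℕ} (hn : 0 < n)
    (Γ D W : Matrix (Fin n) (Fin n) ℂ) (d : Fin n → ℝ)
    (hΓH : Γᴴ = Γ) (hΓ2 : Γ * Γ = 1)
    (hherm : (Γ * D).IsHermitian)
    (hW : Wᴴ * W = 1 ∧ W * Wᴴ = 1)
    (hd : ∀ i, d i ≠ 0)
    (hdecomp : Γ * D = W * Matrix.diagonal (fun i => (d i : ℂ)) * Wᴴ) :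
    ((Γ * W * Matrix.diagonal (fun i => (Real.sign (d i) : ℂ)))ᴴ *
        (Γ * W * Matrix.diagonal (fun i => (Real.sign (d i) : ℂ))) = 1 ∧
      (Γ * W * Matrix.diagonal (fun i => (Real.sign (d i) : ℂ))) *
        (Γ * W * Matrix.diagonal (fun i => (Real.sign (d i) : ℂ)))ᴴ = 1) ∧
    D = (Γ * W * Matrix.diagonal (fun i => (Real.sign (d i) : ℂ))) *
        Matrix.diagonal (fun i => ((|d i| : ℝ) : ℂ)) * Wᴴ := by
  have hSH : (Matrix.diagonal (fun i => (Real.sign (d i) : ℂ)))ᴴ =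
      Matrix.diagonal (fun i => (Real.sign (d i) : ℂ)) := by
    rw [Matrix.diagonal_conjTranspose]
    congr 1
    funext i
    simp
  have hSS : Matrix.diagonal (fun i => (Real.sign (d i) : ℂ)) *
      Matrix.diagonal (fun i => (Real.sign (d i) : ℂ)) = 1 := by
    rw [Matrix.diagonal_mul_diagonal, ← Matrix.diagonal_one]
    congr 1
    funext i
    rcases lt_or_gt_of_ne (hd i) with h | h
    · simp [Real.sign_of_neg h]
    · simp [Real.sign_of_pos h]
  have hSA : Matrix.diagonal (fun i => (Real.sign (d i) : ℂ)) *
      Matrix.diagonal (fun i => ((|d i| : ℝ) : ℂ)) =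
      Matrix.diagonal (fun i => (d i : ℂ)) := by
    rw [Matrix.diagonal_mul_diagonal]
    congr 1
    funext i
    rcases lt_or_gt_of_ne (hd i) with h | h
    · simp [Real.sign_of_neg h, abs_of_neg h]
    · simp [Real.sign_of_pos h, abs_of_pos h]
  have hU : (Γ * W * Matrix.diagonal (fun i => (Real.sign (d i) : ℂ)))ᴴ *
        (Γ * W * Matrix.diagonal (fun i => (Real.sign (d i) : ℂ))) = 1 := by
    rw [Matrix.conjTranspose_mul, Matrix.conjTranspose_mul, hSH, hΓH]
    generalize Matrix.diagonal (fun i => (Real.sign (d i) : ℂ)) = S at *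
    calc S * (Wᴴ * Γ) * (Γ * W * S) = S * (Wᴴ * (Γ * Γ) * W) * S := by
          simp only [Matrix.mul_assoc]
      _ = 1 := by rw [hΓ2, Matrix.mul_one, hW.1, Matrix.mul_one, hSS]
  refine ⟨⟨hU, mul_eq_one_comm.mp hU⟩, ?_⟩
  rw [Matrix.mul_assoc (Γ * W), hSA, Matrix.mul_assoc Γ, Matrix.mul_assoc Γ, ← hdecomp,
    ← Matrix.mul_assoc, hΓ2, Matrix.one_mul]
end

section
/- With the lattice setup below (Nt, Ns ≥ 3), the Wilson–Dirac matrix D_W satisfies ‖D_W^H D_W − D_W D_W^H‖_F² = 16 · Σ_x Σ_{0 ≤ μ < ν ≤ 3} Re(tr(I₃ − Q_x^{μ,ν})), where the outer sum runs over all lattice sites x and Q_x^{μ,ν} is the plaquette at x in the (μ,ν)-plane. -/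
open Matrix

/-- A site of the periodic `Nt × Ns³` lattice `L = (ℤ/Nt) × (ℤ/Ns)³`. -/
abbrev Site (Nt Ns : ℕ) := ZMod Nt × ZMod Ns × ZMod Ns × ZMod Ns

/-- The unit shift `x ↦ x + μ̂` in direction `μ ∈ {0,1,2,3}` on the lattice. -/
def shift {Nt Ns : ℕ} (μ : Fin 4) (x : Site Nt Ns) : Site Nt Ns :=
  (x.1 + (if μ = 0 then 1 else 0),
   x.2.1 + (if μ = 1 then 1 else 0),
   x.2.2.1 + (if μ = 2 then 1 else 0),
   x.2.2.2 + (if μ = 3 then 1 else 0))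

/-- The Wilson–Dirac matrix (lattice spacing `a = 1`, mass `m0`), indexed by
`L × {1,…,4} × {1,…,3}`: the diagonal block at `(x,x)` is `(m0+4)·I₁₂`, the block at
`(x, x+μ̂)` is `-½ (I₄ - γ μ) ⊗ U μ x`, and the block at `(x, x-μ̂)` is
`-½ (I₄ + γ μ) ⊗ (U μ (x-μ̂))ᴴ`; all other blocks vanish. -/
noncomputable def wilsonDirac {Nt Ns : ℕ} (m0 : ℝ)
    (γ : Fin 4 → Matrix (Fin 4) (Fin 4) ℂ)
    (U : Fin 4 → Site Nt Ns → Matrix (Fin 3) (Fin 3) ℂ) :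
    Matrix (Site Nt Ns × Fin 4 × Fin 3) (Site Nt Ns × Fin 4 × Fin 3) ℂ :=
  fun p q =>
    (if q.1 = p.1 ∧ p.2.1 = q.2.1 ∧ p.2.2 = q.2.2 then ((m0 : ℂ) + 4) else 0)
    + ∑ μ : Fin 4,
      ((if q.1 = shift μ p.1 then
          (-(1/2) : ℂ) * ((1 - γ μ) p.2.1 q.2.1) * (U μ p.1) p.2.2 q.2.2 else 0)
       + (if p.1 = shift μ q.1 then
          (-(1/2) : ℂ) * ((1 + γ μ) p.2.1 q.2.1) * ((U μ q.1)ᴴ) p.2.2 q.2.2 else 0))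

/-- The plaquette at site `x` in the `(μ,ν)`-plane:
`Q_x^{μ,ν} = U_ν(x) · U_μ(x+ν̂) · U_ν(x+μ̂)ᴴ · U_μ(x)ᴴ`. -/
noncomputable def plaquette {Nt Ns : ℕ}
    (U : Fin 4 → Site Nt Ns → Matrix (Fin 3) (Fin 3) ℂ) (μ ν : Fin 4) (x : Site Nt Ns) :
    Matrix (Fin 3) (Fin 3) ℂ :=
  U ν x * U μ (shift ν x) * (U ν (shift μ x))ᴴ * (U μ x)ᴴ

/-- The squared Frobenius norm `‖A‖_F² = tr(Aᴴ A)` of a complex matrix. -/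
noncomputable def frobSq {m n : Type*} [Fintype m] [Fintype n]
    (A : Matrix m n ℂ) : ℝ :=
  (Matrix.trace (Aᴴ * A)).re


namespace WilsonAux

/-- Block shift operator. -/
def blk {S : Type*} [DecidableEq S] (f : S → S) (V : S → Matrix (Fin 3) (Fin 3) ℂ) :
    Matrix (S × Fin 3) (S × Fin 3) ℂ :=
  fun p q => if q.1 = f p.1 then V p.1 p.2 q.2 else 0

lemma blk_mul {S : Type*} [DecidableEq S] [Fintype S] (f g : S → S)
    (V W : S → Matrix (Fin 3) (Fin 3) ℂ) :
    blk f V * blk g W = blk (g ∘ f) (fun x => V x * W (f x)) := by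
  ext p q
  simp only [Matrix.mul_apply, blk, Fintype.sum_prod_type, Function.comp]
  rw [Finset.sum_eq_single (f p.1)]
  · by_cases h : q.1 = g (f p.1) <;> simp [h]
  · intro b _ hb
    simp [hb]
  · simp

lemma blk_mul_conj {S : Type*} [DecidableEq S] [Fintype S] (f : S → S)
    (hf : Function.Injective f)
    (V W : S → Matrix (Fin 3) (Fin 3) ℂ) :
    blk f V * (blk f W)ᴴ = blk id (fun x => V x * (W x)ᴴ) := by
  ext p q
  simp only [Matrix.mul_apply, blk, Fintype.sum_prod_type, Matrix.conjTranspose_apply, id]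
  rw [Finset.sum_eq_single (f p.1)]
  · by_cases h : q.1 = p.1
    · simp [h]
    · have : ¬ f p.1 = f q.1 := fun h' => h (hf h').symm
      simp [h, this]
  · intro b _ hb
    simp [hb]
  · simp

lemma blk_trace {S : Type*} [DecidableEq S] [Fintype S]
    (V : S → Matrix (Fin 3) (Fin 3) ℂ) :
    (blk id V).trace = ∑ x, (V x).trace := by
  simp [Matrix.trace, blk, Fintype.sum_prod_type]

lemma blk_one {S : Type*} [DecidableEq S] [Fintype S] :
    blk (S := S) id (fun _ => 1) = 1 := by
  ext p q
  simp only [blk, id, Matrix.one_apply, Prod.ext_iff]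
  by_cases h : q.1 = p.1
  · simp [h]
  · simp [h, Ne.symm h]

/-- `M` moves sites by exactly `a`. -/
def HasShift {S : Type*} [Add S] (M : Matrix (S × Fin 3) (S × Fin 3) ℂ) (a : S) : Prop :=
  ∀ p q, M p q ≠ 0 → q.1 = p.1 + a

lemma HasShift.mul {S : Type*} [AddCommGroup S] [Fintype S]
    {M N : Matrix (S × Fin 3) (S × Fin 3) ℂ} {a b : S} (hM : HasShift M a) (hN : HasShift N b) :
    HasShift (M * N) (a + b) := by
  intro p q h
  rw [Matrix.mul_apply] at h
  obtain ⟨r, -, hr⟩ := Finset.exists_ne_zero_of_sum_ne_zero h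
  rw [hN r q (right_ne_zero_of_mul hr), hM p r (left_ne_zero_of_mul hr), add_assoc]

lemma HasShift.sub {S : Type*} [AddCommGroup S]
    {M N : Matrix (S × Fin 3) (S × Fin 3) ℂ} {a : S} (hM : HasShift M a) (hN : HasShift N a) :
    HasShift (M - N) a := by
  intro p q h
  by_cases h1 : M p q = 0
  · apply hN
    intro h2
    simp [h1, h2] at h
  · exact hM p q h1

lemma HasShift.conj {S : Type*} [AddCommGroup S]
    {M : Matrix (S × Fin 3) (S × Fin 3) ℂ} {a : S} (hM : HasShift M a) :
    HasShift Mᴴ (-a) := by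
  intro p q h
  have : M q p ≠ 0 := by
    intro h2
    simp [Matrix.conjTranspose_apply, h2] at h
  rw [hM q p this]
  abel

lemma HasShift.trace {S : Type*} [AddCommGroup S] [Fintype S]
    {M : Matrix (S × Fin 3) (S × Fin 3) ℂ} {a : S} (hM : HasShift M a) (ha : a ≠ 0) :
    M.trace = 0 := by
  apply Finset.sum_eq_zero
  intro p _
  by_contra h
  have := hM p p h
  simp at this
  exact ha this

/-- Unit vectors. -/
def ev {Nt Ns : ℕ} (μ : Fin 4) : Site Nt Ns := shift μ 0

lemma shift_eq {Nt Ns : ℕ} (μ : Fin 4) (x : Site Nt Ns) : shift μ x = x + ev μ := by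
  simp [shift, ev, Prod.ext_iff]

/-- Signed unit vectors. -/
def dv {Nt Ns : ℕ} (μ : Fin 4) (s : Bool) : Site Nt Ns := if s then ev μ else - ev μ

lemma one_ne {N : ℕ} (h : 3 ≤ N) : (1 : ZMod N) ≠ 0 ∧ (1 : ZMod N) ≠ -1 ∧ (-1 : ZMod N) ≠ 1 := by
  have h1 : (1 : ZMod N) ≠ 0 := by
    haveI : Fact (1 < N) := ⟨by omega⟩
    exact one_ne_zero
  have h2 : (1 : ZMod N) ≠ -1 := by
    haveI : Fact (2 < N) := ⟨by omega⟩
    exact (ZMod.neg_one_ne_one).symm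
  exact ⟨h1, h2, h2.symm⟩

lemma dv_inj {Nt Ns : ℕ} (hNt : 3 ≤ Nt) (hNs : 3 ≤ Ns) (μ μ' : Fin 4) (s s' : Bool)
    (h : (dv μ s : Site Nt Ns) = dv μ' s') : μ = μ' ∧ s = s' := by
  obtain ⟨a1, a2, a3⟩ := one_ne hNt
  obtain ⟨b1, b2, b3⟩ := one_ne hNs
  revert h
  fin_cases μ <;> fin_cases μ' <;> cases s <;> cases s' <;>
    simp [dv, ev, shift, Prod.ext_iff, a1, a2, a3, b1, b2, b3, a1.symm, b1.symm]

lemma dv_sum_inj {Nt Ns : ℕ} (hNt : 3 ≤ Nt) (hNs : 3 ≤ Ns) (ν μ μ' : Fin 4) (s s' t t' : Bool)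
    (hμ : μ ≠ ν) (hμ' : μ' ≠ ν)
    (h : (dv μ s + dv ν t : Site Nt Ns) = dv μ' s' + dv ν t') : μ = μ' ∧ s = s' ∧ t = t' := by
  have ht : t = t' := by
    obtain ⟨a1, a2, a3⟩ := one_ne hNt
    obtain ⟨b1, b2, b3⟩ := one_ne hNs
    revert h
    clear hNt hNs
    fin_cases ν <;> simp only [Prod.ext_iff] <;> simp only [Fin.zero_eta, Fin.mk_one, Fin.reduceFinMk] at hμ hμ' <;>
    cases s <;> cases s' <;> cases t <;> cases t' <;>
      simp [dv, ev, shift, hμ, hμ', hμ.symm, hμ'.symm, a1, a2, a3, b1, b2, b3]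
  subst ht
  obtain ⟨h1, h2⟩ := dv_inj hNt hNs μ μ' s s' (add_right_cancel h)
  exact ⟨h1, h2, rfl⟩

section
variable {Nt Ns : ℕ} [NeZero Nt] [NeZero Ns]

/-- Gauge covariant translation. -/
def T (U : Fin 4 → Site Nt Ns → Matrix (Fin 3) (Fin 3) ℂ) (μ : Fin 4) :
    Matrix (Site Nt Ns × Fin 3) (Site Nt Ns × Fin 3) ℂ := blk (shift μ) (U μ)

/-- Translation or its adjoint. -/
noncomputable def X (U : Fin 4 → Site Nt Ns → Matrix (Fin 3) (Fin 3) ℂ) (μ : Fin 4) (s : Bool) :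
    Matrix (Site Nt Ns × Fin 3) (Site Nt Ns × Fin 3) ℂ := if s then T U μ else (T U μ)ᴴ

variable (U : Fin 4 → Site Nt Ns → Matrix (Fin 3) (Fin 3) ℂ)

lemma T_shift (μ : Fin 4) : HasShift (T U μ) (ev μ) := by
  intro p q h
  by_contra h2
  rw [← shift_eq] at h2
  simp [T, blk, h2] at h

lemma X_shift (μ : Fin 4) (s : Bool) : HasShift (X U μ s) (dv μ s) := by
  cases s
  · simpa [X, dv] using (T_shift U μ).conj
  · simpa [X, dv] using T_shift U μ

lemma shift_inj (μ : Fin 4) : Function.Injective (shift μ : Site Nt Ns → Site Nt Ns) := by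
  intro x y h
  rw [shift_eq, shift_eq] at h
  exact add_right_cancel h

lemma shift_comm (μ ν : Fin 4) : (shift μ ∘ shift ν : Site Nt Ns → Site Nt Ns) = shift ν ∘ shift μ := by
  ext1 x
  simp only [Function.comp, shift_eq]
  abel

lemma T_unit (hU : ∀ μ x, U μ x ∈ Matrix.unitaryGroup (Fin 3) ℂ) (μ : Fin 4) :
    T U μ * (T U μ)ᴴ = 1 := by
  rw [T, blk_mul_conj _ (shift_inj μ), ← blk_one]
  congr 1
  ext1 x
  exact (Matrix.mem_unitaryGroup_iff).1 (hU μ x)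

lemma T_plaq (μ ν : Fin 4) :
    ((T U ν * T U μ) * (T U μ * T U ν)ᴴ).trace = ∑ x, (plaquette U μ ν x).trace := by
  rw [T, T, blk_mul, blk_mul, shift_comm ν μ, blk_mul_conj, blk_trace]
  · simp [plaquette, Matrix.conjTranspose_mul, Matrix.mul_assoc]
  · exact (shift_inj μ).comp (shift_inj ν)

lemma X_unit (hU : ∀ μ x, U μ x ∈ Matrix.unitaryGroup (Fin 3) ℂ) (μ : Fin 4) (s : Bool) :
    X U μ s * (X U μ s)ᴴ = 1 := by
  have h := T_unit U hU μ
  cases s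
  · simpa [X] using _root_.mul_eq_one_comm.1 h
  · simpa [X] using h

end

lemma comm_trace {n : Type*} [Fintype n] [DecidableEq n] (A B : Matrix n n ℂ)
    (hA : A * Aᴴ = 1) (hB : B * Bᴴ = 1) :
    ((A * B - B * A)ᴴ * (A * B - B * A)).trace =
      2 * (1 : Matrix n n ℂ).trace - (B * A * Bᴴ * Aᴴ).trace - (A * B * Aᴴ * Bᴴ).trace := by
  have hA' := _root_.mul_eq_one_comm.1 hA
  have hB' := _root_.mul_eq_one_comm.1 hB
  have e1 : (Bᴴ * Aᴴ * (A * B)) = 1 := by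
    rw [Matrix.mul_assoc, ← Matrix.mul_assoc Aᴴ, hA', Matrix.one_mul, hB']
  have e2 : (Aᴴ * Bᴴ * (B * A)) = 1 := by
    rw [Matrix.mul_assoc, ← Matrix.mul_assoc Bᴴ, hB', Matrix.one_mul, hA']
  have e3 : (Bᴴ * Aᴴ * (B * A)).trace = (B * A * Bᴴ * Aᴴ).trace := by
    rw [Matrix.trace_mul_comm]; simp only [Matrix.mul_assoc]
  have e4 : (Aᴴ * Bᴴ * (A * B)).trace = (A * B * Aᴴ * Bᴴ).trace := by
    rw [Matrix.trace_mul_comm]; simp only [Matrix.mul_assoc]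
  rw [Matrix.conjTranspose_sub, Matrix.conjTranspose_mul, Matrix.conjTranspose_mul,
    Matrix.sub_mul, Matrix.mul_sub, Matrix.mul_sub, e1, e2]
  simp only [Matrix.trace_sub, e3, e4]
  ring

section
variable {Nt Ns : ℕ} [NeZero Nt] [NeZero Ns]
variable (U : Fin 4 → Site Nt Ns → Matrix (Fin 3) (Fin 3) ℂ)

lemma X_comm_trace (hU : ∀ μ x, U μ x ∈ Matrix.unitaryGroup (Fin 3) ℂ) (μ ν : Fin 4) (s t : Bool) :
    ((X U μ s * X U ν t - X U ν t * X U μ s)ᴴ *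
      (X U μ s * X U ν t - X U ν t * X U μ s)).trace =
      2 * (1 : Matrix (Site Nt Ns × Fin 3) (Site Nt Ns × Fin 3) ℂ).trace
       - (T U ν * T U μ * (T U ν)ᴴ * (T U μ)ᴴ).trace
       - (T U μ * T U ν * (T U μ)ᴴ * (T U ν)ᴴ).trace := by
  rw [comm_trace _ _ (X_unit U hU μ s) (X_unit U hU ν t)]
  have cyc : ∀ P Q R S : Matrix (Site Nt Ns × Fin 3) (Site Nt Ns × Fin 3) ℂ,
      (P * Q * R * S).trace = (Q * R * S * P).trace := by
    intro P Q R S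
    rw [Matrix.mul_assoc, Matrix.mul_assoc, Matrix.trace_mul_comm]
    simp only [Matrix.mul_assoc]
  cases s <;> cases t <;> simp only [X, if_true, Bool.false_eq_true, if_false,
    Matrix.conjTranspose_conjTranspose]
  · rw [cyc (T U ν)ᴴ, cyc (T U μ)ᴴ (T U ν), cyc (T U μ)ᴴ, cyc (T U ν)ᴴ (T U μ)]
  · rw [cyc (T U μ)ᴴ (T U ν), cyc (T U μ) (T U ν) (T U μ)ᴴ]
    ring
  · rw [cyc (T U ν)ᴴ (T U μ), cyc (T U ν) (T U μ) (T U ν)ᴴ]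
    ring

/-- The plaquette sum. -/
noncomputable def G (μ ν : Fin 4) : ℝ :=
  ∑ x : Site Nt Ns, (Matrix.trace ((1 : Matrix (Fin 3) (Fin 3) ℂ) - plaquette U μ ν x)).re

lemma plaq_re (μ ν : Fin 4) :
    ((T U ν * T U μ * (T U ν)ᴴ * (T U μ)ᴴ).trace).re = ∑ x, ((plaquette U μ ν x).trace).re := by
  rw [← Complex.re_sum, ← T_plaq, Matrix.conjTranspose_mul, Matrix.mul_assoc (T U ν * T U μ)]

lemma plaq_symm (μ ν : Fin 4) :
    ((T U ν * T U μ * (T U ν)ᴴ * (T U μ)ᴴ).trace).re =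
    ((T U μ * T U ν * (T U μ)ᴴ * (T U ν)ᴴ).trace).re := by
  have : (T U ν * T U μ * (T U ν)ᴴ * (T U μ)ᴴ) = (T U μ * T U ν * (T U μ)ᴴ * (T U ν)ᴴ)ᴴ := by
    simp [Matrix.conjTranspose_mul, Matrix.mul_assoc]
  rw [this, Matrix.trace_conjTranspose]
  simp

lemma G_eq (μ ν : Fin 4) : G U μ ν =
    (1 : Matrix (Site Nt Ns × Fin 3) (Site Nt Ns × Fin 3) ℂ).trace.re -
      ((T U ν * T U μ * (T U ν)ᴴ * (T U μ)ᴴ).trace).re := by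
  rw [plaq_re, G]
  simp [Matrix.trace_sub, Finset.sum_sub_distrib]

lemma G_symm (μ ν : Fin 4) : G U μ ν = G U ν μ := by
  rw [G_eq, G_eq, plaq_symm]

lemma X_comm_re (hU : ∀ μ x, U μ x ∈ Matrix.unitaryGroup (Fin 3) ℂ) (μ ν : Fin 4) (s t : Bool) :
    (((X U μ s * X U ν t - X U ν t * X U μ s)ᴴ *
      (X U μ s * X U ν t - X U ν t * X U μ s)).trace).re = 2 * G U μ ν := by
  rw [X_comm_trace U hU, G_eq, Complex.sub_re, Complex.sub_re, ← plaq_symm]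
  simp only [Complex.mul_re, Complex.re_ofNat, Complex.im_ofNat]
  ring

/-- signs -/
def sg (t : Bool) : ℂ := if t then 1 else -1

/-- elementary commutators -/
noncomputable def Z (ν : Fin 4) (i : Fin 4 × Bool × Bool) :
    Matrix (Site Nt Ns × Fin 3) (Site Nt Ns × Fin 3) ℂ :=
  sg i.2.2 • (X U i.1 i.2.1 * X U ν i.2.2 - X U ν i.2.2 * X U i.1 i.2.1)

/-- index set -/
def idx (ν : Fin 4) : Finset (Fin 4 × Bool × Bool) := Finset.univ.filter (fun i => i.1 ≠ ν)

lemma Z_cross (hNt : 3 ≤ Nt) (hNs : 3 ≤ Ns) (ν : Fin 4) (i j : Fin 4 × Bool × Bool)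
    (hi : i ∈ idx ν) (hj : j ∈ idx ν) (hij : i ≠ j) : ((Z U ν i)ᴴ * Z U ν j).trace = 0 := by
  obtain ⟨μ, s, t⟩ := i
  obtain ⟨μ', s', t'⟩ := j
  simp only [idx, Finset.mem_filter, Finset.mem_univ, true_and] at hi hj
  simp only [Z, Matrix.conjTranspose_smul, Matrix.smul_mul, Matrix.mul_smul, Matrix.trace_smul]
  have key : ∀ μ s t, HasShift (X U μ s * X U ν t - X U ν t * X U μ s) (dv μ s + dv ν t) := by
    intro μ s t
    refine ((X_shift U μ s).mul (X_shift U ν t)).sub ?_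
    rw [add_comm]
    exact (X_shift U ν t).mul (X_shift U μ s)
  rw [((key μ s t).conj.mul (key μ' s' t')).trace, smul_zero, smul_zero]
  intro h
  have h' := eq_of_sub_eq_zero ((neg_add_eq_sub _ _).symm.trans h)
  obtain ⟨h1, h2, h3⟩ := dv_sum_inj hNt hNs ν μ' μ s' s t' t hj hi h'
  exact hij (by rw [h1, h2, h3])

lemma Z_diag (hU : ∀ μ x, U μ x ∈ Matrix.unitaryGroup (Fin 3) ℂ) (ν : Fin 4)
    (i : Fin 4 × Bool × Bool) : (((Z U ν i)ᴴ * Z U ν i).trace).re = 2 * G U i.1 ν := by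
  rw [← X_comm_re U hU i.1 ν i.2.1 i.2.2, Z]
  rw [Matrix.conjTranspose_smul, Matrix.smul_mul, Matrix.mul_smul, smul_smul]
  have : star (sg i.2.2) * sg i.2.2 = 1 := by
    cases i.2.2 <;> simp [sg]
  rw [this, one_smul]

/-- The commutator `Σ_μ [S_μ, R_ν]`. -/
noncomputable def W (ν : Fin 4) : Matrix (Site Nt Ns × Fin 3) (Site Nt Ns × Fin 3) ℂ :=
  (∑ μ, (T U μ + (T U μ)ᴴ)) * (T U ν - (T U ν)ᴴ) - (T U ν - (T U ν)ᴴ) * (∑ μ, (T U μ + (T U μ)ᴴ))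

lemma W_eq (hU : ∀ μ x, U μ x ∈ Matrix.unitaryGroup (Fin 3) ℂ) (ν : Fin 4) :
    W U ν = ∑ i ∈ idx ν, Z U ν i := by
  have h1 : W U ν = ∑ i, Z U ν i := by
    rw [W, Finset.sum_mul, Finset.mul_sum, ← Finset.sum_sub_distrib, Fintype.sum_prod_type]
    refine Finset.sum_congr rfl fun μ _ => ?_
    simp only [Fintype.sum_prod_type, Fintype.sum_bool, Z, X, sg, if_true, Bool.false_eq_true,
      if_false, one_smul, neg_smul]
    noncomm_ring
  rw [h1]
  have h2 : ∑ i, Z U ν i = ∑ i ∈ idx ν, Z U ν i +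
      ∑ i ∈ Finset.univ.filter (fun i : Fin 4 × Bool × Bool => ¬ i.1 ≠ ν), Z U ν i :=
    (Finset.sum_filter_add_sum_filter_not _ _ _).symm
  rw [h2, add_eq_left]
  refine Finset.sum_eq_zero fun i hi => ?_
  simp only [ne_eq, not_not, Finset.mem_filter, Finset.mem_univ, true_and] at hi
  have h3 := T_unit U hU ν
  have h4 := _root_.mul_eq_one_comm.1 h3
  obtain ⟨μ, s, t⟩ := i
  simp only at hi
  subst hi
  cases s <;> cases t <;> simp [Z, X, h3, h4]

lemma W_trace (hNt : 3 ≤ Nt) (hNs : 3 ≤ Ns)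
    (hU : ∀ μ x, U μ x ∈ Matrix.unitaryGroup (Fin 3) ℂ) (ν : Fin 4) :
    (((W U ν)ᴴ * W U ν).trace).re = ∑ i ∈ idx ν, 2 * G U i.1 ν := by
  rw [W_eq U hU, Matrix.conjTranspose_sum, Finset.sum_mul, Matrix.trace_sum, Complex.re_sum]
  refine Finset.sum_congr rfl fun i hi => ?_
  rw [Finset.mul_sum, Matrix.trace_sum, Finset.sum_eq_single i, Z_diag U hU]
  · intro j hj hji
    exact Z_cross U hNt hNs ν i j hi hj hji.symm
  · intro h
    exact absurd hi h

lemma W_trace_sum (hNt : 3 ≤ Nt) (hNs : 3 ≤ Ns)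
    (hU : ∀ μ x, U μ x ∈ Matrix.unitaryGroup (Fin 3) ℂ) :
    ∑ ν, (((W U ν)ᴴ * W U ν).trace).re =
      16 * ∑ μ : Fin 4, ∑ ν ∈ Finset.univ.filter (fun ν => μ < ν), G U μ ν := by
  simp only [W_trace U hNt hNs hU, idx, Finset.sum_filter, Fintype.sum_prod_type,
    Fintype.sum_bool, Fin.sum_univ_four]
  rw [G_symm U 1 0, G_symm U 2 0, G_symm U 3 0, G_symm U 2 1, G_symm U 3 1, G_symm U 3 2]
  simp
  ring

/-- index reshuffling -/
def eqv : Site Nt Ns × Fin 4 × Fin 3 ≃ Fin 4 × (Site Nt Ns × Fin 3) where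
  toFun p := (p.2.1, (p.1, p.2.2))
  invFun q := (q.2.1, q.1, q.2.2)
  left_inv _ := rfl
  right_inv _ := rfl

open scoped Kronecker

/-- hermitian part -/
noncomputable def HA (m0 : ℝ) : Matrix (Fin 4 × (Site Nt Ns × Fin 3)) (Fin 4 × (Site Nt Ns × Fin 3)) ℂ :=
  (1 : Matrix (Fin 4) (Fin 4) ℂ) ⊗ₖ
    (((m0 : ℂ) + 4) • (1 : Matrix (Site Nt Ns × Fin 3) (Site Nt Ns × Fin 3) ℂ)
      - (1/2 : ℂ) • ∑ μ, (T U μ + (T U μ)ᴴ))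

/-- antihermitian part -/
noncomputable def HB (γ : Fin 4 → Matrix (Fin 4) (Fin 4) ℂ) :
    Matrix (Fin 4 × (Site Nt Ns × Fin 3)) (Fin 4 × (Site Nt Ns × Fin 3)) ℂ :=
  ∑ μ, γ μ ⊗ₖ ((1/2 : ℂ) • (T U μ - (T U μ)ᴴ))

lemma wd_eq (m0 : ℝ) (γ : Fin 4 → Matrix (Fin 4) (Fin 4) ℂ) :
    wilsonDirac m0 γ U = (HA U m0 + HB U γ).submatrix eqv eqv := by
  ext ⟨x, a, i⟩ ⟨y, b, j⟩
  simp only [wilsonDirac, HA, HB, Matrix.submatrix_apply, eqv, Equiv.coe_fn_mk, Matrix.add_apply,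
    Matrix.sum_apply, Matrix.kroneckerMap_apply, Matrix.sub_apply, Matrix.smul_apply, smul_eq_mul,
    Matrix.conjTranspose_apply, T, blk, Matrix.one_apply, Prod.mk.injEq]
  rw [mul_sub, sub_add_eq_add_sub, add_sub_assoc]
  congr 1
  · by_cases h1 : x = y <;> by_cases h2 : a = b <;> by_cases h3 : i = j <;>
      simp [h1, h2, h3, eq_comm]
  · rw [Finset.mul_sum, Finset.mul_sum, ← Finset.sum_sub_distrib]
    refine Finset.sum_congr rfl fun μ _ => ?_
    have e : star (if x = shift μ y then U μ y j i else 0) =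
        if x = shift μ y then star (U μ y j i) else 0 := by
      split_ifs <;> simp
    rw [e]
    split_ifs <;> ring

lemma HA_herm (m0 : ℝ) : (HA U m0)ᴴ = HA U m0 := by
  rw [HA, Matrix.conjTranspose_kronecker]
  congr 1
  · simp
  · simp [Matrix.conjTranspose_sum, Matrix.conjTranspose_smul, add_comm]

lemma HB_herm (γ : Fin 4 → Matrix (Fin 4) (Fin 4) ℂ) (hγH : ∀ μ, (γ μ)ᴴ = γ μ) :
    (HB U γ)ᴴ = - HB U γ := by
  rw [HB, Matrix.conjTranspose_sum, ← Finset.sum_neg_distrib]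
  refine Finset.sum_congr rfl fun μ _ => ?_
  rw [Matrix.conjTranspose_kronecker, hγH]
  ext p q
  simp [Matrix.kroneckerMap_apply]
  ring

lemma comm_eq (m0 : ℝ) (γ : Fin 4 → Matrix (Fin 4) (Fin 4) ℂ) :
    HA U m0 * HB U γ - HB U γ * HA U m0 = (-(1/4) : ℂ) • ∑ ν, (γ ν ⊗ₖ W U ν) := by
  rw [HB, Finset.mul_sum, Finset.sum_mul, ← Finset.sum_sub_distrib, Finset.smul_sum]
  refine Finset.sum_congr rfl fun ν _ => ?_
  rw [HA, ← Matrix.mul_kronecker_mul, ← Matrix.mul_kronecker_mul, Matrix.one_mul, Matrix.mul_one]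
  have : (-(1/4) : ℂ) • (γ ν ⊗ₖ W U ν) = γ ν ⊗ₖ ((-(1/4) : ℂ) • W U ν) := by
    rw [Matrix.kronecker_smul]
  rw [this]
  have h2 : ∀ (M : Matrix (Fin 4) (Fin 4) ℂ) (P Q : Matrix (Site Nt Ns × Fin 3) (Site Nt Ns × Fin 3) ℂ),
      M ⊗ₖ P - M ⊗ₖ Q = M ⊗ₖ (P - Q) := by
    intro M P Q
    ext p q
    simp [Matrix.kroneckerMap_apply, mul_sub]
  rw [h2]
  congr 1
  rw [W]
  simp only [Matrix.sub_mul, Matrix.mul_sub, Matrix.smul_mul, Matrix.mul_smul, Matrix.one_mul,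
    Matrix.mul_one]
  module

lemma gamma_trace (γ : Fin 4 → Matrix (Fin 4) (Fin 4) ℂ)
    (hγC : ∀ μ ν, γ μ * γ ν + γ ν * γ μ =
      if μ = ν then (2 : ℂ) • (1 : Matrix (Fin 4) (Fin 4) ℂ) else 0) (μ ν : Fin 4) :
    (γ μ * γ ν).trace = if μ = ν then 4 else 0 := by
  have h := congrArg Matrix.trace (hγC μ ν)
  rw [Matrix.trace_add, Matrix.trace_mul_comm (γ ν)] at h
  by_cases e : μ = ν
  · simp [e] at h ⊢
    linear_combination h / 2
  · simp [e] at h ⊢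
    exact h

lemma frob_comm (γ : Fin 4 → Matrix (Fin 4) (Fin 4) ℂ)
    (hγH : ∀ μ, (γ μ)ᴴ = γ μ)
    (hγC : ∀ μ ν, γ μ * γ ν + γ ν * γ μ =
      if μ = ν then (2 : ℂ) • (1 : Matrix (Fin 4) (Fin 4) ℂ) else 0) :
    ((∑ ν, γ ν ⊗ₖ W U ν)ᴴ * (∑ ν, γ ν ⊗ₖ W U ν)).trace =
      4 * ∑ ν, ((W U ν)ᴴ * W U ν).trace := by
  rw [Matrix.conjTranspose_sum, Finset.sum_mul, Matrix.trace_sum, Finset.mul_sum]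
  refine Finset.sum_congr rfl fun ν _ => ?_
  rw [Finset.mul_sum, Matrix.trace_sum, Finset.sum_eq_single ν]
  · rw [Matrix.conjTranspose_kronecker, ← Matrix.mul_kronecker_mul, Matrix.trace_kronecker, hγH,
      gamma_trace γ hγC]
    simp
  · intro μ _ h
    rw [Matrix.conjTranspose_kronecker, ← Matrix.mul_kronecker_mul, Matrix.trace_kronecker, hγH,
      gamma_trace γ hγC]
    simp [h.symm]
  · simp

lemma trace_sub_eqv (M : Matrix (Fin 4 × (Site Nt Ns × Fin 3)) (Fin 4 × (Site Nt Ns × Fin 3)) ℂ) :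
    (M.submatrix eqv eqv).trace = M.trace := by
  simp only [Matrix.trace, Matrix.diag_apply, Matrix.submatrix_apply]
  exact Equiv.sum_comp eqv (fun i => M i i)

end

end WilsonAux

/-- `‖D_Wᴴ D_W - D_W D_Wᴴ‖_F² = 16 Σ_x Σ_{μ<ν} Re tr(I₃ - Q_x^{μ,ν})`. -/
theorem wilson_nonnormality_eq_sum_plaquettes {Nt Ns : ℕ} [NeZero Nt] [NeZero Ns]
    (hNt : 3 ≤ Nt) (hNs : 3 ≤ Ns) (m0 : ℝ)
    (γ : Fin 4 → Matrix (Fin 4) (Fin 4) ℂ)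
    (hγH : ∀ μ, (γ μ)ᴴ = γ μ)
    (hγC : ∀ μ ν, γ μ * γ ν + γ ν * γ μ =
      if μ = ν then (2 : ℂ) • (1 : Matrix (Fin 4) (Fin 4) ℂ) else 0)
    (U : Fin 4 → Site Nt Ns → Matrix (Fin 3) (Fin 3) ℂ)
    (hU : ∀ μ x, U μ x ∈ Matrix.unitaryGroup (Fin 3) ℂ) :
    frobSq ((wilsonDirac m0 γ U)ᴴ * wilsonDirac m0 γ U -
        wilsonDirac m0 γ U * (wilsonDirac m0 γ U)ᴴ) =
      16 * ∑ x : Site Nt Ns, ∑ μ : Fin 4, ∑ ν ∈ Finset.univ.filter (fun ν => μ < ν),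
        (Matrix.trace ((1 : Matrix (Fin 3) (Fin 3) ℂ) - plaquette U μ ν x)).re := by
  have hD : (wilsonDirac m0 γ U)ᴴ * wilsonDirac m0 γ U -
        wilsonDirac m0 γ U * (wilsonDirac m0 γ U)ᴴ =
      (((-(1/2) : ℂ)) • ∑ ν, Matrix.kroneckerMap (· * ·) (γ ν) (WilsonAux.W U ν)).submatrix
        WilsonAux.eqv WilsonAux.eqv := by
    rw [WilsonAux.wd_eq, Matrix.conjTranspose_submatrix, Matrix.submatrix_mul_equiv,
      Matrix.submatrix_mul_equiv, Matrix.conjTranspose_add,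
      WilsonAux.HA_herm, WilsonAux.HB_herm U γ hγH]
    have hs : ∀ M N : Matrix (Fin 4 × (Site Nt Ns × Fin 3)) (Fin 4 × (Site Nt Ns × Fin 3)) ℂ,
        M.submatrix WilsonAux.eqv WilsonAux.eqv - N.submatrix WilsonAux.eqv WilsonAux.eqv =
          (M - N).submatrix WilsonAux.eqv WilsonAux.eqv := fun _ _ => rfl
    rw [hs]
    congr 1
    have h := WilsonAux.comm_eq U m0 γ
    have h2 : ((-(1/2) : ℂ)) • ∑ ν, Matrix.kroneckerMap (· * ·) (γ ν) (WilsonAux.W U ν) =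
      (2 : ℂ) • (WilsonAux.HA U m0 * WilsonAux.HB U γ - WilsonAux.HB U γ * WilsonAux.HA U m0) := by
      rw [h, smul_smul]
      norm_num
    rw [h2, two_smul]
    noncomm_ring
  have hR : ∑ x : Site Nt Ns, ∑ μ : Fin 4, ∑ ν ∈ Finset.univ.filter (fun ν => μ < ν),
        (Matrix.trace ((1 : Matrix (Fin 3) (Fin 3) ℂ) - plaquette U μ ν x)).re =
      ∑ μ : Fin 4, ∑ ν ∈ Finset.univ.filter (fun ν => μ < ν), WilsonAux.G U μ ν := by
    rw [Finset.sum_comm]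
    refine Finset.sum_congr rfl fun μ _ => ?_
    rw [Finset.sum_comm]
    rfl
  rw [hR, ← WilsonAux.W_trace_sum U hNt hNs hU, hD, frobSq, Matrix.conjTranspose_submatrix,
    Matrix.submatrix_mul_equiv, WilsonAux.trace_sub_eqv, Matrix.conjTranspose_smul,
    Matrix.smul_mul, Matrix.mul_smul, Matrix.trace_smul, Matrix.trace_smul, smul_smul,
    WilsonAux.frob_comm U γ hγH hγC, ← Complex.re_sum]
  congr 1
  rw [smul_eq_mul, ← mul_assoc]
  convert one_mul _ using 2
  norm_num
end

section
/- With the lattice setup below (Nt, Ns ≥ 3), if the gauge field is pure gauge, i.e. there exists a map V assigning to each site x a unitary matrix V(x) ∈ U(3) such that U_μ(x) = V(x)·V(x+μ̂)^H for all x and μ, then the Wilson–Dirac matrix D_W is normal: D_W^H D_W = D_W D_W^H. In particular this holds for the free theory where U_μ(x) = I₃ for all x, μ. -/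
open Matrix

theorem shift_comm {Nt Ns : ℕ} (μ ν : Fin 4) (x : Site Nt Ns) :
    shift μ (shift ν x) = shift ν (shift μ x) := by
  simp only [shift, Prod.mk.injEq]
  refine ⟨?_, ?_, ?_, ?_⟩ <;> ring

theorem shift_inj {Nt Ns : ℕ} (μ : Fin 4) (x y : Site Nt Ns) :
    shift μ x = shift μ y ↔ x = y := by
  simp [shift, Prod.ext_iff]

/-- Free shift matrix. -/
noncomputable def shiftMat {Nt Ns : ℕ} (μ : Fin 4) : Matrix (Site Nt Ns) (Site Nt Ns) ℂ :=
  fun x y => if y = shift μ x then 1 else 0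

theorem shiftMat_comm {Nt Ns : ℕ} [NeZero Nt] [NeZero Ns] (μ ν : Fin 4) :
    (shiftMat μ : Matrix (Site Nt Ns) (Site Nt Ns) ℂ) * shiftMat ν = shiftMat ν * shiftMat μ := by
  ext x y
  simp only [Matrix.mul_apply, shiftMat]
  rw [Finset.sum_eq_single (shift μ x) (by intro b _ hb; simp [hb]) (by simp),
    Finset.sum_eq_single (shift ν x) (by intro b _ hb; simp [hb]) (by simp)]
  simp [shift_comm μ ν]

theorem shiftMat_unit {Nt Ns : ℕ} [NeZero Nt] [NeZero Ns] (μ : Fin 4) :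
    (shiftMat μ : Matrix (Site Nt Ns) (Site Nt Ns) ℂ) * (shiftMat μ)ᴴ = 1 := by
  ext x y
  simp only [Matrix.mul_apply, shiftMat, Matrix.one_apply, conjTranspose_apply]
  rw [Finset.sum_eq_single (shift μ x) (by intro b _ hb; simp [hb]) (by simp)]
  simp only [shift_inj]
  split_ifs <;> simp

theorem shiftMat_comm_star {Nt Ns : ℕ} [NeZero Nt] [NeZero Ns] (μ ν : Fin 4) :
    (shiftMat μ : Matrix (Site Nt Ns) (Site Nt Ns) ℂ) * (shiftMat ν)ᴴ
      = (shiftMat ν)ᴴ * shiftMat μ := by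
  have h1 := shiftMat_unit (Nt := Nt) (Ns := Ns) ν
  have h2 := mul_eq_one_comm.mp h1
  calc (shiftMat μ : Matrix (Site Nt Ns) (Site Nt Ns) ℂ) * (shiftMat ν)ᴴ
      = ((shiftMat ν)ᴴ * shiftMat ν) * (shiftMat μ * (shiftMat ν)ᴴ) := by rw [h2, one_mul]
    _ = (shiftMat ν)ᴴ * (shiftMat ν * shiftMat μ) * (shiftMat ν)ᴴ := by simp only [mul_assoc]
    _ = (shiftMat ν)ᴴ * shiftMat μ * (shiftMat ν * (shiftMat ν)ᴴ) := by
        rw [shiftMat_comm ν μ]; simp only [mul_assoc]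
    _ = _ := by rw [h1, mul_one]

/-- Abstract normality. -/
theorem abstract_normal {n : Type*} [Fintype n] [DecidableEq n] (c : ℝ)
    (G T : Fin 4 → Matrix n n ℂ) (hG : ∀ μ, (G μ)ᴴ = G μ)
    (hGT : ∀ μ ν, Commute (G μ) (T ν)) (hTT : ∀ μ ν, Commute (T μ) (T ν))
    (hTS : ∀ μ ν, Commute (T μ) (T ν)ᴴ) (D : Matrix n n ℂ)
    (hD : D = (c : ℂ) • (1 : Matrix n n ℂ) + ∑ μ, ((-(1/2) : ℂ) • ((1 - G μ) * T μ)
      + (-(1/2) : ℂ) • ((1 + G μ) * (T μ)ᴴ))) :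
    Dᴴ * D = D * Dᴴ := by
  have hGS : ∀ μ ν, Commute (G μ) (T ν)ᴴ := by
    intro μ ν
    have := congrArg conjTranspose (hGT μ ν).eq
    simp only [conjTranspose_mul, hG] at this
    exact this.symm
  have hSS : ∀ μ ν, Commute (T μ)ᴴ (T ν)ᴴ := by
    intro μ ν
    have := congrArg conjTranspose (hTT μ ν).eq
    simp only [conjTranspose_mul] at this
    exact this.symm
  set A : Matrix n n ℂ := (c : ℂ) • (1 : Matrix n n ℂ) + ∑ μ, (-(1/2) : ℂ) • (T μ + (T μ)ᴴ) with hA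
  set K : Matrix n n ℂ := ∑ μ, (1/2 : ℂ) • (G μ * (T μ - (T μ)ᴴ)) with hK
  have hDA : D = A + K := by
    rw [hD, hA, hK, add_assoc, ← Finset.sum_add_distrib]
    congr 1
    refine Finset.sum_congr rfl fun μ _ => ?_
    simp only [sub_mul, add_mul, mul_sub, one_mul]
    module
  have hAH : Aᴴ = A := by
    rw [hA]
    simp [conjTranspose_sum, add_comm]
  have hKH : Kᴴ = -K := by
    rw [hK]
    simp only [conjTranspose_sum, conjTranspose_smul, conjTranspose_mul, conjTranspose_sub,
      conjTranspose_conjTranspose, hG, ← Finset.sum_neg_distrib]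
    refine Finset.sum_congr rfl fun μ _ => ?_
    rw [sub_mul, mul_sub, ← (hGT μ μ).eq, ← (hGS μ μ).eq]
    simp
    module
  have hAK : Commute A K := by
    rw [hA, hK]
    refine Commute.sum_right _ _ _ fun ν _ => Commute.smul_right ?_ _
    refine Commute.add_left ((Commute.one_left _).smul_left _) ?_
    refine Commute.sum_left _ _ _ fun μ _ => Commute.smul_left ?_ _
    refine Commute.mul_right ((hGT ν μ).symm.add_left (hGS ν μ).symm) ?_
    exact ((hTT μ ν).sub_right (hTS μ ν)).add_left ((hTS ν μ).symm.sub_right (hSS μ ν))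
  have := hAK.eq
  rw [hDA, conjTranspose_add, hAH, hKH]
  simp only [add_mul, mul_add, neg_mul, mul_neg, this]
  abel

theorem free_normal {Nt Ns : ℕ} [NeZero Nt] [NeZero Ns] (m0 : ℝ)
    (γ : Fin 4 → Matrix (Fin 4) (Fin 4) ℂ) (hγH : ∀ μ, (γ μ)ᴴ = γ μ) :
    (wilsonDirac (Nt := Nt) (Ns := Ns) m0 γ (fun _ _ => 1))ᴴ
        * wilsonDirac (Nt := Nt) (Ns := Ns) m0 γ (fun _ _ => 1) =
      wilsonDirac (Nt := Nt) (Ns := Ns) m0 γ (fun _ _ => 1)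
        * (wilsonDirac (Nt := Nt) (Ns := Ns) m0 γ (fun _ _ => 1))ᴴ := by
  refine abstract_normal (m0 + 4)
    (fun μ => kronecker (1 : Matrix (Site Nt Ns) (Site Nt Ns) ℂ)
      (kronecker (γ μ) (1 : Matrix (Fin 3) (Fin 3) ℂ)))
    (fun μ => kronecker (shiftMat μ : Matrix (Site Nt Ns) (Site Nt Ns) ℂ)
      (1 : Matrix (Fin 4 × Fin 3) (Fin 4 × Fin 3) ℂ)) ?_ ?_ ?_ ?_ _ ?_
  · intro μ
    simp only [kronecker, conjTranspose_kronecker, conjTranspose_one, hγH]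
  · intro μ ν
    simp only [Commute, SemiconjBy, kronecker, ← mul_kronecker_mul, one_mul, mul_one]
  · intro μ ν
    simp only [Commute, SemiconjBy, kronecker, ← mul_kronecker_mul, one_mul, mul_one,
      shiftMat_comm μ ν]
  · intro μ ν
    simp only [Commute, SemiconjBy, kronecker, conjTranspose_kronecker, conjTranspose_one,
      ← mul_kronecker_mul, one_mul, mul_one, shiftMat_comm_star μ ν]
  · have h1 : ∀ μ, (1 : Matrix (Site Nt Ns × Fin 4 × Fin 3) (Site Nt Ns × Fin 4 × Fin 3) ℂ)
        - kronecker (1 : Matrix (Site Nt Ns) (Site Nt Ns) ℂ)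
          (kronecker (γ μ) (1 : Matrix (Fin 3) (Fin 3) ℂ))
        = kronecker 1 (kronecker (1 - γ μ) 1) := by
      intro μ
      simp only [kronecker]
      rw [show (1 : Matrix (Site Nt Ns × Fin 4 × Fin 3) (Site Nt Ns × Fin 4 × Fin 3) ℂ)
        = kroneckerMap (fun a b => a * b) 1 (kroneckerMap (fun a b => a * b) 1 1) by
          rw [one_kronecker_one, one_kronecker_one]]
      ext ⟨x, s, a⟩ ⟨y, t, b⟩
      simp only [kroneckerMap_apply, Matrix.sub_apply]
      ring
    have h2 : ∀ μ, (1 : Matrix (Site Nt Ns × Fin 4 × Fin 3) (Site Nt Ns × Fin 4 × Fin 3) ℂ)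
        + kronecker (1 : Matrix (Site Nt Ns) (Site Nt Ns) ℂ)
          (kronecker (γ μ) (1 : Matrix (Fin 3) (Fin 3) ℂ))
        = kronecker 1 (kronecker (1 + γ μ) 1) := by
      intro μ
      simp only [kronecker]
      rw [show (1 : Matrix (Site Nt Ns × Fin 4 × Fin 3) (Site Nt Ns × Fin 4 × Fin 3) ℂ)
        = kroneckerMap (fun a b => a * b) 1 (kroneckerMap (fun a b => a * b) 1 1) by
          rw [one_kronecker_one, one_kronecker_one]]
      ext ⟨x, s, a⟩ ⟨y, t, b⟩
      simp only [kroneckerMap_apply, Matrix.add_apply]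
      ring
    simp only [h1, h2]
    simp only [kronecker, conjTranspose_kronecker, conjTranspose_one, ← mul_kronecker_mul,
      one_mul, mul_one]
    ext ⟨x, s, a⟩ ⟨y, t, b⟩
    simp only [wilsonDirac, Matrix.add_apply, Matrix.smul_apply, Matrix.sum_apply, kroneckerMap_apply, smul_eq_mul,
      conjTranspose_apply, shiftMat, conjTranspose_one]
    congr 1
    · simp only [one_apply, Prod.mk.injEq, eq_comm (a := y) (b := x)]
      push_cast
      simp
    · refine Finset.sum_congr rfl fun μ _ => ?_
      have hs : star ((1 : Matrix (Fin 3) (Fin 3) ℂ) b a) = (1 : Matrix (Fin 3) (Fin 3) ℂ) a b := by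
        simp only [one_apply, eq_comm (a := b) (b := a)]
        split_ifs <;> simp
      rw [hs]
      congr 1 <;> split_ifs <;> simp [mul_assoc]

/-- Gauge transformation. -/
noncomputable def gaugeMat {Nt Ns : ℕ} (V : Site Nt Ns → Matrix (Fin 3) (Fin 3) ℂ) :
    Matrix (Site Nt Ns × Fin 4 × Fin 3) (Site Nt Ns × Fin 4 × Fin 3) ℂ :=
  fun p q => if p.1 = q.1 then if p.2.1 = q.2.1 then V p.1 p.2.2 q.2.2 else 0 else 0

theorem mul_gauge {Nt Ns : ℕ} [NeZero Nt] [NeZero Ns] (V : Site Nt Ns → Matrix (Fin 3) (Fin 3) ℂ)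
    (D : Matrix (Site Nt Ns × Fin 4 × Fin 3) (Site Nt Ns × Fin 4 × Fin 3) ℂ) (p y t d) :
    (D * gaugeMat V) p (y, t, d) = ∑ c, D p (y, t, c) * V y c d := by
  simp only [mul_apply, gaugeMat]
  rw [Fintype.sum_prod_type]
  rw [Finset.sum_eq_single y (by intro b _ hb; simp [hb]) (by simp), Fintype.sum_prod_type,
    Finset.sum_eq_single t (by intro b _ hb; simp [hb]) (by simp)]
  simp

theorem gauge_mul {Nt Ns : ℕ} [NeZero Nt] [NeZero Ns] (V : Site Nt Ns → Matrix (Fin 3) (Fin 3) ℂ)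
    (D : Matrix (Site Nt Ns × Fin 4 × Fin 3) (Site Nt Ns × Fin 4 × Fin 3) ℂ) (q x s a) :
    (gaugeMat V * D) (x, s, a) q = ∑ c, V x a c * D (x, s, c) q := by
  simp only [mul_apply, gaugeMat]
  rw [Fintype.sum_prod_type]
  rw [Finset.sum_eq_single x (by intro b _ hb; simp [hb.symm]) (by simp), Fintype.sum_prod_type,
    Finset.sum_eq_single s (by intro b _ hb; simp [hb.symm]) (by simp)]
  simp

theorem gauge_unit {Nt Ns : ℕ} [NeZero Nt] [NeZero Ns] (V : Site Nt Ns → Matrix (Fin 3) (Fin 3) ℂ)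
    (hV : ∀ x, V x * (V x)ᴴ = 1) : gaugeMat V * (gaugeMat V)ᴴ = 1 := by
  ext ⟨x, s, a⟩ ⟨y, t, b⟩
  rw [gauge_mul]
  have h := congrFun (congrFun (hV x) a) b
  simp only [mul_apply, conjTranspose_apply, one_apply] at h
  simp only [conjTranspose_apply, gaugeMat, one_apply, Prod.mk.injEq]
  by_cases hx : y = x
  · subst hx
    by_cases hs : t = s
    · subst hs
      simpa using h
    · simp [hs, Ne.symm hs]
  · simp [hx, Ne.symm hx]

theorem wilson_gauge {Nt Ns : ℕ} [NeZero Nt] [NeZero Ns] (m0 : ℝ)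
    (γ : Fin 4 → Matrix (Fin 4) (Fin 4) ℂ)
    (U : Fin 4 → Site Nt Ns → Matrix (Fin 3) (Fin 3) ℂ)
    (V : Site Nt Ns → Matrix (Fin 3) (Fin 3) ℂ)
    (h1 : ∀ μ x, U μ x * V (shift μ x) = V x)
    (h2 : ∀ μ x, (U μ x)ᴴ * V x = V (shift μ x)) :
    wilsonDirac m0 γ U * gaugeMat V = gaugeMat V * wilsonDirac m0 γ (fun _ _ => 1) := by
  ext ⟨x, s, a⟩ ⟨y, t, b⟩
  rw [gauge_mul, mul_gauge]
  simp only [wilsonDirac, add_mul, mul_add, Finset.sum_add_distrib, Finset.sum_mul,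
    Finset.mul_sum]
  congr 1
  · by_cases hx : y = x
    · subst hx
      by_cases hs : s = t
      · simp [hs, mul_comm]
      · simp [hs]
    · simp [hx]
  · congr 1
    · rw [Finset.sum_comm, Finset.sum_comm (s := (Finset.univ : Finset (Fin 3)))]
      refine Finset.sum_congr rfl fun μ _ => ?_
      split_ifs with h
      · subst h
        have h := congrFun (congrFun (h1 μ x) a) b
        simp only [mul_apply] at h
        simp only [mul_assoc, ← Finset.mul_sum, h]
        simp [one_apply]
        ring
      · simp
    · rw [Finset.sum_comm, Finset.sum_comm (s := (Finset.univ : Finset (Fin 3)))]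
      refine Finset.sum_congr rfl fun μ _ => ?_
      split_ifs with h
      · subst h
        have h := congrFun (congrFun (h2 μ y) a) b
        simp only [mul_apply] at h
        simp only [mul_assoc, ← Finset.mul_sum, h]
        simp [one_apply]
        ring
      · simp

/-- if the gauge field is pure gauge, `U_μ(x) = V(x)·V(x+μ̂)ᴴ`, then the
Wilson–Dirac matrix is normal. (In particular this holds for the free theory `U_μ(x) = I₃`.) -/
theorem wilson_normal_of_pure_gauge {Nt Ns : ℕ} [NeZero Nt] [NeZero Ns]
    (hNt : 3 ≤ Nt) (hNs : 3 ≤ Ns) (m0 : ℝ)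
    (γ : Fin 4 → Matrix (Fin 4) (Fin 4) ℂ)
    (hγH : ∀ μ, (γ μ)ᴴ = γ μ)
    (hγC : ∀ μ ν, γ μ * γ ν + γ ν * γ μ =
      if μ = ν then (2 : ℂ) • (1 : Matrix (Fin 4) (Fin 4) ℂ) else 0)
    (U : Fin 4 → Site Nt Ns → Matrix (Fin 3) (Fin 3) ℂ)
    (hU : ∀ μ x, U μ x ∈ Matrix.unitaryGroup (Fin 3) ℂ)
    (V : Site Nt Ns → Matrix (Fin 3) (Fin 3) ℂ)
    (hV : ∀ x, V x ∈ Matrix.unitaryGroup (Fin 3) ℂ)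
    (hUV : ∀ μ x, U μ x = V x * (V (shift μ x))ᴴ) :
    (wilsonDirac m0 γ U)ᴴ * wilsonDirac m0 γ U =
      wilsonDirac m0 γ U * (wilsonDirac m0 γ U)ᴴ := by
  have hV1 : ∀ x, V x * (V x)ᴴ = 1 := fun x => mem_unitaryGroup_iff.mp (hV x)
  have hV2 : ∀ x, (V x)ᴴ * V x = 1 := fun x => mem_unitaryGroup_iff'.mp (hV x)
  have hg := wilson_gauge m0 γ U V
    (by intro μ x; rw [hUV, mul_assoc, hV2, mul_one])
    (by intro μ x
        rw [hUV, conjTranspose_mul, conjTranspose_conjTranspose, mul_assoc, hV2, mul_one])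
  have hW := gauge_unit V hV1
  have hW' := mul_eq_one_comm.mp hW
  have hn := free_normal (Nt := Nt) (Ns := Ns) m0 γ hγH
  generalize wilsonDirac m0 γ (fun _ _ => 1) = E at hg hn
  have hD : wilsonDirac m0 γ U = gaugeMat V * E * (gaugeMat V)ᴴ := by
    rw [← hg, mul_assoc, hW, mul_one]
  generalize gaugeMat V = W at *
  have key : ∀ X Y : Matrix (Site Nt Ns × Fin 4 × Fin 3) (Site Nt Ns × Fin 4 × Fin 3) ℂ,
      (W * X * Wᴴ) * (W * Y * Wᴴ) = W * (X * Y) * Wᴴ := by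
    intro X Y
    calc (W * X * Wᴴ) * (W * Y * Wᴴ) = W * X * (Wᴴ * W) * (Y * Wᴴ) := by simp only [mul_assoc]
      _ = _ := by rw [hW']; simp only [mul_one, mul_assoc]
  have hDH : (W * E * Wᴴ)ᴴ = W * Eᴴ * Wᴴ := by
    simp only [conjTranspose_mul, conjTranspose_conjTranspose, mul_assoc]
  rw [hD, hDH, key, key, hn]
end

section
/- With the lattice setup below (Nt, Ns ≥ 3), let N_Q = 6·|L| be the total number of plaquettes and Q_avg = N_Q⁻¹ · Σ_x Σ_{0 ≤ μ < ν ≤ 3} Re(tr(Q_x^{μ,ν})) the average plaquette value. Then ‖D_W^H D_W − D_W D_W^H‖_F² = 16·N_Q·(3 − Q_avg). -/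
open Matrix

/-- The unit vector in direction `μ`. -/
def eVec {Nt Ns : ℕ} (μ : Fin 4) : Site Nt Ns :=
  ((if μ = 0 then 1 else 0), (if μ = 1 then 1 else 0), (if μ = 2 then 1 else 0),
    (if μ = 3 then 1 else 0))

lemma shift_eq {Nt Ns : ℕ} (μ : Fin 4) (x : Site Nt Ns) : shift μ x = x + eVec μ := rfl

/-- Signed unit vector. -/
def sVec {Nt Ns : ℕ} (μ : Fin 4) (s : Bool) : Site Nt Ns :=
  if s then eVec μ else - eVec μ

lemma zmod_one_ne {N : ℕ} (h : 3 ≤ N) : (1 : ZMod N) ≠ 0 := by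
  intro h1
  have h2 := (ZMod.natCast_eq_zero_iff 1 N).1 (by exact_mod_cast h1)
  have := Nat.le_of_dvd (by norm_num) h2
  omega

lemma zmod_two_ne {N : ℕ} (h : 3 ≤ N) : (1 : ZMod N) + 1 ≠ 0 := by
  intro h1
  have h2 := (ZMod.natCast_eq_zero_iff 2 N).1 (by push_cast; rw [← h1]; norm_num)
  have := Nat.le_of_dvd (by norm_num) h2
  omega

lemma coord_exists {Nt Ns : ℕ} (hNt : 3 ≤ Nt) (hNs : 3 ≤ Ns) (κ : Fin 4) :
    ∃ N : ℕ, 3 ≤ N ∧ ∃ π : Site Nt Ns →+ ZMod N, ∀ μ s,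
      π (sVec μ s) = if μ = κ then (if s then 1 else -1) else 0 := by
  fin_cases κ
  · refine ⟨Nt, hNt, AddMonoidHom.fst _ _, fun μ s => ?_⟩
    cases s <;> simp [sVec, eVec] <;> split_ifs <;> simp
  · refine ⟨Ns, hNs, (AddMonoidHom.fst _ _).comp (AddMonoidHom.snd _ _), fun μ s => ?_⟩
    cases s <;> simp [sVec, eVec] <;> split_ifs <;> simp
  · refine ⟨Ns, hNs, (AddMonoidHom.fst _ _).comp ((AddMonoidHom.snd _ _).comp
      (AddMonoidHom.snd _ _)), fun μ s => ?_⟩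
    cases s <;> simp [sVec, eVec] <;> split_ifs <;> simp
  · refine ⟨Ns, hNs, (AddMonoidHom.snd _ _).comp ((AddMonoidHom.snd _ _).comp
      (AddMonoidHom.snd _ _)), fun μ s => ?_⟩
    cases s <;> simp [sVec, eVec] <;> split_ifs <;> simp

lemma sign_inj {N : ℕ} (hN : 3 ≤ N) (s s' : Bool)
    (h : (if s then 1 else -1 : ZMod N) = if s' then 1 else -1) : s = s' := by
  have a2 := zmod_two_ne hN
  have a3 : (1 : ZMod N) ≠ -1 := fun h => a2 (by nth_rewrite 1 [h]; simp)
  cases s <;> cases s' <;> simp at h ⊢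
  · exact a3 h.symm
  · exact a3 h

lemma sVec_inj {Nt Ns : ℕ} (hNt : 3 ≤ Nt) (hNs : 3 ≤ Ns) (ν μ μ' : Fin 4) (s t s' t' : Bool)
    (h1 : μ ≠ ν) (h2 : μ' ≠ ν)
    (h : (sVec μ s + sVec ν t : Site Nt Ns) = sVec μ' s' + sVec ν t') :
    μ = μ' ∧ s = s' ∧ t = t' := by
  obtain ⟨N, hN, π, hπ⟩ := coord_exists hNt hNs μ
  obtain ⟨N', hN', π', hπ'⟩ := coord_exists hNt hNs ν
  have e := congrArg π h
  have e' := congrArg π' h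
  rw [map_add, map_add, hπ, hπ, hπ, hπ, if_pos rfl, if_neg h1.symm, add_zero,
    if_neg h1.symm, add_zero] at e
  rw [map_add, map_add, hπ', hπ', hπ', hπ', if_pos rfl, if_neg h1, if_neg h2, zero_add,
    zero_add, if_pos rfl] at e'
  have ht := sign_inj hN' _ _ e'
  by_cases hm : μ' = μ
  · rw [if_pos hm] at e
    exact ⟨hm.symm, sign_inj hN _ _ e, ht⟩
  · rw [if_neg hm] at e
    have a1 := zmod_one_ne hN
    cases s <;> simp at e
    · exact absurd e a1
    · exact absurd e a1

set_option linter.unusedSectionVars false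

section
variable {Nt Ns : ℕ} [NeZero Nt] [NeZero Ns]

/-- `M` moves by `d`. -/
def IsSh (d : Site Nt Ns) (M : Matrix (Site Nt Ns × Fin 3) (Site Nt Ns × Fin 3) ℂ) : Prop :=
  ∀ p q, q.1 ≠ p.1 + d → M p q = 0

lemma IsSh.mul {d d' : Site Nt Ns} {M N : Matrix (Site Nt Ns × Fin 3) (Site Nt Ns × Fin 3) ℂ}
    (hM : IsSh d M) (hN : IsSh d' N) : IsSh (d + d') (M * N) := by
  intro p q hpq
  rw [Matrix.mul_apply]
  apply Finset.sum_eq_zero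
  intro r _
  by_cases h : r.1 = p.1 + d
  · rw [hN r q (by rw [h, add_assoc]; exact hpq), mul_zero]
  · rw [hM p r h, zero_mul]

lemma IsSh.conj {d : Site Nt Ns} {M : Matrix (Site Nt Ns × Fin 3) (Site Nt Ns × Fin 3) ℂ}
    (hM : IsSh d M) : IsSh (-d) Mᴴ := by
  intro p q hpq
  rw [Matrix.conjTranspose_apply, hM q p, star_zero]
  intro h
  apply hpq
  rw [h]; abel

lemma IsSh.sub {d : Site Nt Ns} {M N : Matrix (Site Nt Ns × Fin 3) (Site Nt Ns × Fin 3) ℂ}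
    (hM : IsSh d M) (hN : IsSh d N) : IsSh d (M - N) := by
  intro p q hpq
  rw [Matrix.sub_apply, hM p q hpq, hN p q hpq, sub_zero]

lemma IsSh.smul {d : Site Nt Ns} {M : Matrix (Site Nt Ns × Fin 3) (Site Nt Ns × Fin 3) ℂ}
    (c : ℂ) (hM : IsSh d M) : IsSh d (c • M) := by
  intro p q hpq
  rw [Matrix.smul_apply, hM p q hpq, smul_zero]

lemma IsSh.trace {d : Site Nt Ns} {M : Matrix (Site Nt Ns × Fin 3) (Site Nt Ns × Fin 3) ℂ}
    (hM : IsSh d M) (hd : d ≠ 0) : M.trace = 0 := by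
  apply Finset.sum_eq_zero
  intro p _
  apply hM
  intro h
  exact hd (by simpa using h)

/-- Covariant shift. -/
noncomputable def TT (U : Fin 4 → Site Nt Ns → Matrix (Fin 3) (Fin 3) ℂ) (μ : Fin 4) :
    Matrix (Site Nt Ns × Fin 3) (Site Nt Ns × Fin 3) ℂ :=
  fun p q => if q.1 = shift μ p.1 then U μ p.1 p.2 q.2 else 0

/-- `T` or its adjoint. -/
noncomputable def ZZ (U : Fin 4 → Site Nt Ns → Matrix (Fin 3) (Fin 3) ℂ) (μ : Fin 4) (s : Bool) :
    Matrix (Site Nt Ns × Fin 3) (Site Nt Ns × Fin 3) ℂ :=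
  if s then TT U μ else (TT U μ)ᴴ

/-- sign -/
def sg (s : Bool) : ℂ := if s then 1 else -1

/-- Signed commutators. -/
noncomputable def XX (U : Fin 4 → Site Nt Ns → Matrix (Fin 3) (Fin 3) ℂ) (ν : Fin 4)
    (i : Fin 4 × Bool × Bool) :
    Matrix (Site Nt Ns × Fin 3) (Site Nt Ns × Fin 3) ℂ :=
  sg i.2.2 • (ZZ U i.1 i.2.1 * ZZ U ν i.2.2 - ZZ U ν i.2.2 * ZZ U i.1 i.2.1)

variable (U : Fin 4 → Site Nt Ns → Matrix (Fin 3) (Fin 3) ℂ)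

lemma TT_sh (μ : Fin 4) : IsSh (eVec μ) (TT U μ) := by
  intro p q h
  rw [TT, if_neg]
  exact h

lemma ZZ_sh (μ : Fin 4) (s : Bool) : IsSh (sVec μ s) (ZZ U μ s) := by
  cases s
  · simpa [ZZ, sVec] using (TT_sh U μ).conj
  · simpa [ZZ, sVec] using (TT_sh U μ)

lemma XX_sh (ν : Fin 4) (i : Fin 4 × Bool × Bool) :
    IsSh (sVec i.1 i.2.1 + sVec ν i.2.2) (XX U ν i) := by
  apply IsSh.smul
  apply IsSh.sub
  · exact (ZZ_sh U _ _).mul (ZZ_sh U _ _)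
  · rw [add_comm]; exact (ZZ_sh U _ _).mul (ZZ_sh U _ _)

lemma TT_mul_conj (hU : ∀ μ x, U μ x ∈ Matrix.unitaryGroup (Fin 3) ℂ) (μ : Fin 4) :
    TT U μ * (TT U μ)ᴴ = 1 := by
  ext ⟨x, a⟩ ⟨y, b⟩
  rw [Matrix.mul_apply, Fintype.sum_prod_type]
  rw [Finset.sum_eq_single (shift μ x)]
  · by_cases hxy : x = y
    · subst hxy
      have := congrFun (congrFun (Matrix.mem_unitaryGroup_iff.1 (hU μ x)) a) b
      rw [Matrix.mul_apply] at this
      simpa [TT, Matrix.one_apply, Matrix.star_eq_conjTranspose] using this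
    · have : shift μ x ≠ shift μ y := by
        rw [shift_eq, shift_eq]; simpa using hxy
      simp [TT, Matrix.one_apply, hxy, this]
  · intro z _ hz
    simp [TT, hz]
  · simp

lemma TT_conj_mul (hU : ∀ μ x, U μ x ∈ Matrix.unitaryGroup (Fin 3) ℂ) (μ : Fin 4) :
    (TT U μ)ᴴ * TT U μ = 1 := mul_eq_one_comm.1 (TT_mul_conj U hU μ)

lemma ZZ_mul_conj (hU : ∀ μ x, U μ x ∈ Matrix.unitaryGroup (Fin 3) ℂ) (μ : Fin 4) (s : Bool) :
    ZZ U μ s * (ZZ U μ s)ᴴ = 1 := by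
  cases s
  · simpa [ZZ] using TT_conj_mul U hU μ
  · simpa [ZZ] using TT_mul_conj U hU μ

lemma XX_self (hU : ∀ μ x, U μ x ∈ Matrix.unitaryGroup (Fin 3) ℂ) (ν : Fin 4) (s t : Bool) :
    XX U ν (ν, s, t) = 0 := by
  have h1 := TT_mul_conj U hU ν
  have h2 := TT_conj_mul U hU ν
  cases s <;> cases t <;> simp [XX, ZZ, h1, h2]

lemma XX_orth (hNt : 3 ≤ Nt) (hNs : 3 ≤ Ns)
    (hU : ∀ μ x, U μ x ∈ Matrix.unitaryGroup (Fin 3) ℂ) (ν : Fin 4)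
    (i j : Fin 4 × Bool × Bool) (hij : i ≠ j) : ((XX U ν i)ᴴ * XX U ν j).trace = 0 := by
  obtain ⟨μ, s, t⟩ := i
  obtain ⟨μ', s', t'⟩ := j
  by_cases h1 : μ = ν
  · subst h1; rw [XX_self U hU]; simp
  by_cases h2 : μ' = ν
  · subst h2; rw [XX_self U hU μ']; simp
  refine ((XX_sh U ν _).conj.mul (XX_sh U ν _)).trace ?_
  intro h
  have h3 := sVec_inj hNt hNs ν μ μ' s t s' t' h1 h2 (neg_add_eq_zero.1 h)
  obtain ⟨rfl, rfl, rfl⟩ := h3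
  exact hij rfl

lemma trace_WW (hNt : 3 ≤ Nt) (hNs : 3 ≤ Ns)
    (hU : ∀ μ x, U μ x ∈ Matrix.unitaryGroup (Fin 3) ℂ) (ν : Fin 4) :
    ((∑ i, XX U ν i)ᴴ * ∑ i, XX U ν i).trace = ∑ i, ((XX U ν i)ᴴ * XX U ν i).trace := by
  rw [Matrix.conjTranspose_sum, Finset.sum_mul, Matrix.trace_sum]
  refine Finset.sum_congr rfl fun i _ => ?_
  rw [Finset.mul_sum, Matrix.trace_sum, Finset.sum_eq_single i]
  · intro j _ hj
    exact XX_orth U hNt hNs hU ν i j hj.symm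
  · simp

end

lemma trace_comm {n : Type*} [Fintype n] [DecidableEq n] (X Y : Matrix n n ℂ)
    (hX : X * Xᴴ = 1) (hY : Y * Yᴴ = 1) :
    ((X * Y - Y * X)ᴴ * (X * Y - Y * X)).trace.re =
      2 * (Fintype.card n : ℝ) - 2 * (X * Y * Xᴴ * Yᴴ).trace.re := by
  have hX' := mul_eq_one_comm.1 hX
  have hY' := mul_eq_one_comm.1 hY
  have e : (X * Y - Y * X)ᴴ * (X * Y - Y * X) =
      Yᴴ * (Xᴴ * X) * Y - (Xᴴ * Yᴴ * X * Y)ᴴ - Xᴴ * Yᴴ * X * Y + Xᴴ * (Yᴴ * Y) * X := by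
    simp only [Matrix.conjTranspose_sub, Matrix.conjTranspose_mul,
      Matrix.conjTranspose_conjTranspose]
    noncomm_ring
  have e2 : (Xᴴ * Yᴴ * X * Y).trace = (X * Y * Xᴴ * Yᴴ).trace := by
    rw [mul_assoc (Xᴴ * Yᴴ), Matrix.trace_mul_comm, ← mul_assoc]
  rw [e, hX', hY']
  simp only [mul_one, hX', hY', Matrix.trace_add, Matrix.trace_sub, Matrix.trace_conjTranspose,
    e2, Matrix.trace_one]
  simp
  ring

lemma trace_flip {n : Type*} [Fintype n] [DecidableEq n] (X Y : Matrix n n ℂ) :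
    (Xᴴ * Y * X * Yᴴ).trace.re = (X * Y * Xᴴ * Yᴴ).trace.re := by
  have e : (Xᴴ * Y * X * Yᴴ)ᴴ = Y * (Xᴴ * Yᴴ * X) := by
    simp only [Matrix.conjTranspose_mul, Matrix.conjTranspose_conjTranspose, mul_assoc]
  have e2 : (Y * (Xᴴ * Yᴴ * X)).trace = (X * Y * Xᴴ * Yᴴ).trace := by
    rw [← mul_assoc, Matrix.trace_mul_comm]
    simp only [mul_assoc]
  have h3 : (star (Xᴴ * Y * X * Yᴴ).trace) = (X * Y * Xᴴ * Yᴴ).trace := by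
    rw [← Matrix.trace_conjTranspose, e, e2]
  rw [← h3]; simp

lemma trace_symm {n : Type*} [Fintype n] [DecidableEq n] (X Y : Matrix n n ℂ) :
    (Y * X * Yᴴ * Xᴴ).trace.re = (X * Y * Xᴴ * Yᴴ).trace.re := by
  have e : (Y * X * Yᴴ * Xᴴ)ᴴ = X * Y * Xᴴ * Yᴴ := by
    simp only [Matrix.conjTranspose_mul, Matrix.conjTranspose_conjTranspose, mul_assoc]
  rw [← e, Matrix.trace_conjTranspose]; simp

section
variable {Nt Ns : ℕ} [NeZero Nt] [NeZero Ns]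
variable (U : Fin 4 → Site Nt Ns → Matrix (Fin 3) (Fin 3) ℂ)

/-- Summed plaquette as a trace. -/
noncomputable def gg (μ ν : Fin 4) : ℝ :=
  (TT U ν * TT U μ * (TT U ν)ᴴ * (TT U μ)ᴴ).trace.re

lemma trace_XX (hU : ∀ μ x, U μ x ∈ Matrix.unitaryGroup (Fin 3) ℂ) (ν : Fin 4)
    (i : Fin 4 × Bool × Bool) : ((XX U ν i)ᴴ * XX U ν i).trace.re =
      2 * (Fintype.card (Site Nt Ns × Fin 3) : ℝ) - 2 * gg U i.1 ν := by
  obtain ⟨μ, s, t⟩ := i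
  have h1 : ((XX U ν (μ, s, t))ᴴ * XX U ν (μ, s, t)) =
      (ZZ U μ s * ZZ U ν t - ZZ U ν t * ZZ U μ s)ᴴ *
        (ZZ U μ s * ZZ U ν t - ZZ U ν t * ZZ U μ s) := by
    cases t <;> simp [XX, sg]
    noncomm_ring
  rw [h1, trace_comm _ _ (ZZ_mul_conj U hU μ s) (ZZ_mul_conj U hU ν t)]
  congr 2
  rw [gg, trace_symm]
  cases s <;> cases t <;> simp only [ZZ, if_true, Bool.false_eq_true, if_false,
    Matrix.conjTranspose_conjTranspose]
  · have h2 := trace_flip (TT U ν) ((TT U μ)ᴴ)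
    rw [Matrix.conjTranspose_conjTranspose] at h2
    have h3 := trace_symm ((TT U μ)ᴴ) (TT U ν)
    rw [Matrix.conjTranspose_conjTranspose] at h3
    rw [h2, h3, trace_flip, trace_symm]
  · have h3 := trace_symm ((TT U μ)ᴴ) (TT U ν)
    rw [Matrix.conjTranspose_conjTranspose] at h3
    rw [h3, trace_flip, trace_symm]
  · rw [trace_symm, trace_flip, trace_symm]

lemma gg_symm (μ ν : Fin 4) : gg U μ ν = gg U ν μ := trace_symm _ _

lemma gg_self (hU : ∀ μ x, U μ x ∈ Matrix.unitaryGroup (Fin 3) ℂ) (μ : Fin 4) :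
    gg U μ μ = (Fintype.card (Site Nt Ns × Fin 3) : ℝ) := by
  rw [gg, mul_assoc (TT U μ), TT_mul_conj U hU, mul_one, TT_mul_conj U hU, Matrix.trace_one]
  simp

lemma TT_mul (μ ν : Fin 4) (x : Site Nt Ns) (a : Fin 3) (q : Site Nt Ns × Fin 3) :
    (TT U ν * TT U μ) (x, a) q =
      if q.1 = shift μ (shift ν x) then (U ν x * U μ (shift ν x)) a q.2 else 0 := by
  rw [Matrix.mul_apply, Fintype.sum_prod_type, Finset.sum_eq_single (shift ν x)]
  · split_ifs with h
    · simp [TT, h, Matrix.mul_apply]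
    · simp [TT, h]
  · intro z _ hz
    simp [TT, hz]
  · simp

lemma gg_eq (μ ν : Fin 4) : gg U μ ν = ∑ x, (plaquette U μ ν x).trace.re := by
  have e : TT U ν * TT U μ * (TT U ν)ᴴ * (TT U μ)ᴴ =
      (TT U ν * TT U μ) * (TT U μ * TT U ν)ᴴ := by
    rw [Matrix.conjTranspose_mul, mul_assoc (TT U ν * TT U μ)]
  have hp : ∀ x, plaquette U μ ν x = 
      (U ν x * U μ (shift ν x)) * (U μ x * U ν (shift μ x))ᴴ := by
    intro x
    rw [plaquette, Matrix.conjTranspose_mul, mul_assoc (U ν x * U μ (shift ν x))]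
  rw [gg, e, ← Complex.re_sum]
  congr 1
  rw [Matrix.trace, Fintype.sum_prod_type]
  refine Finset.sum_congr rfl fun x _ => ?_
  rw [hp, Matrix.trace]
  refine Finset.sum_congr rfl fun a _ => ?_
  have hs : shift ν (shift μ x) = shift μ (shift ν x) := by
    simp only [shift_eq]; abel
  rw [Matrix.diag_apply, Matrix.diag_apply, Matrix.mul_apply, Matrix.mul_apply,
    Fintype.sum_prod_type, Finset.sum_eq_single (shift μ (shift ν x))]
  · refine Finset.sum_congr rfl fun b _ => ?_
    rw [Matrix.conjTranspose_apply, Matrix.conjTranspose_apply, TT_mul, TT_mul, hs]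
    simp
  · intro z _ hz
    refine Finset.sum_eq_zero fun b _ => ?_
    rw [TT_mul]
    simp [hz]
  · simp

open Kronecker

/-- Hermitian scalar part -/
noncomputable def aa (m0 : ℝ) : Matrix (Site Nt Ns × Fin 3) (Site Nt Ns × Fin 3) ℂ :=
  ((m0 : ℂ) + 4) • 1 - (1/2 : ℂ) • ∑ μ, (TT U μ + (TT U μ)ᴴ)

/-- Antihermitian part -/
noncomputable def bb (γ : Fin 4 → Matrix (Fin 4) (Fin 4) ℂ) :
    Matrix (Fin 4 × (Site Nt Ns × Fin 3)) (Fin 4 × (Site Nt Ns × Fin 3)) ℂ :=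
  (1/2 : ℂ) • ∑ μ, γ μ ⊗ₖ (TT U μ - (TT U μ)ᴴ)

/-- reordering of the index -/
def reord : (Site Nt Ns × Fin 4 × Fin 3) ≃ Fin 4 × (Site Nt Ns × Fin 3) where
  toFun p := (p.2.1, (p.1, p.2.2))
  invFun p := (p.2.1, p.1, p.2.2)
  left_inv _ := rfl
  right_inv _ := rfl

lemma wilson_eq (m0 : ℝ) (γ : Fin 4 → Matrix (Fin 4) (Fin 4) ℂ) :
    wilsonDirac m0 γ U = ((1 : Matrix (Fin 4) (Fin 4) ℂ) ⊗ₖ aa U m0 + bb U γ).submatrix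
      reord reord := by
  ext ⟨x, i, a⟩ ⟨y, j, b⟩
  simp only [wilsonDirac, aa, bb, reord, Equiv.coe_fn_mk, Matrix.submatrix_apply, Matrix.add_apply,
    Matrix.kroneckerMap_apply, Matrix.sub_apply, Matrix.smul_apply, Matrix.sum_apply, smul_eq_mul,
    Finset.mul_sum, mul_sub]
  rw [sub_add, ← Finset.sum_sub_distrib, sub_eq_add_neg, ← Finset.sum_neg_distrib]
  congr 1
  · by_cases h1 : y = x <;> by_cases h2 : i = j <;> by_cases h3 : a = b <;>
      simp [Matrix.one_apply, h1, h2, h3, eq_comm (a := x) (b := y)]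
  · refine Finset.sum_congr rfl fun μ _ => ?_
    simp only [TT, Matrix.conjTranspose_apply]
    split_ifs <;> simp <;> ring

lemma aa_conj (m0 : ℝ) : (aa U m0)ᴴ = aa U m0 := by
  simp [aa, Matrix.conjTranspose_sub, Matrix.conjTranspose_smul, Matrix.conjTranspose_sum, add_comm]

lemma bb_conj (γ : Fin 4 → Matrix (Fin 4) (Fin 4) ℂ) (hγH : ∀ μ, (γ μ)ᴴ = γ μ) :
    (bb U γ)ᴴ = - bb U γ := by
  simp only [bb, Matrix.conjTranspose_smul, Matrix.conjTranspose_sum,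
    Matrix.conjTranspose_kronecker, hγH, Matrix.conjTranspose_sub,
    Matrix.conjTranspose_conjTranspose]
  rw [← smul_neg, ← Finset.sum_neg_distrib]
  congr 1
  · simp
  · refine Finset.sum_congr rfl fun μ _ => ?_
    ext p q
    simp [Matrix.kroneckerMap_apply]
    ring

lemma sum_XX (ν : Fin 4) (m0 : ℝ) : ∑ i, XX U ν i = (-2 : ℂ) •
    (aa U m0 * (TT U ν - (TT U ν)ᴴ) - (TT U ν - (TT U ν)ᴴ) * aa U m0) := by
  have e : ∀ c : ℂ, ∀ S R : Matrix (Site Nt Ns × Fin 3) (Site Nt Ns × Fin 3) ℂ,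
      (-2 : ℂ) • ((c • 1 - (1/2 : ℂ) • S) * R - R * (c • 1 - (1/2 : ℂ) • S)) = S * R - R * S := by
    intro c S R
    simp only [sub_mul, mul_sub, Matrix.smul_mul, Matrix.mul_smul, one_mul, mul_one]
    module
  rw [aa, e, Finset.sum_mul, Finset.mul_sum, ← Finset.sum_sub_distrib, Fintype.sum_prod_type]
  refine Finset.sum_congr rfl fun μ _ => ?_
  simp [Fintype.sum_prod_type, XX, ZZ, sg]
  noncomm_ring

lemma comm_eq (m0 : ℝ) (γ : Fin 4 → Matrix (Fin 4) (Fin 4) ℂ) (hγH : ∀ μ, (γ μ)ᴴ = γ μ) :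
    (wilsonDirac m0 γ U)ᴴ * wilsonDirac m0 γ U - wilsonDirac m0 γ U * (wilsonDirac m0 γ U)ᴴ =
    ((-1/2 : ℂ) • ∑ ν, γ ν ⊗ₖ (∑ i, XX U ν i)).submatrix reord reord := by
  have e : ∀ A B : Matrix (Fin 4 × (Site Nt Ns × Fin 3)) (Fin 4 × (Site Nt Ns × Fin 3)) ℂ,
      (A + -B) * (A + B) - (A + B) * (A + -B) = (2 : ℂ) • (A * B - B * A) := by
    intro A B
    rw [two_smul]
    noncomm_ring
  have hsub : ∀ A B : Matrix (Fin 4 × (Site Nt Ns × Fin 3)) (Fin 4 × (Site Nt Ns × Fin 3)) ℂ,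
      A.submatrix reord reord - B.submatrix reord reord =
        (A - B).submatrix (reord (Nt := Nt) (Ns := Ns)) reord := fun _ _ => rfl
  rw [wilson_eq, Matrix.conjTranspose_submatrix, Matrix.submatrix_mul_equiv,
    Matrix.submatrix_mul_equiv, hsub, Matrix.conjTranspose_add,
    Matrix.conjTranspose_kronecker, Matrix.conjTranspose_one, aa_conj, bb_conj U γ hγH]
  congr 1
  rw [e]
  simp only [sum_XX U _ m0, bb, Matrix.mul_smul, Matrix.smul_mul, Finset.mul_sum, Finset.sum_mul,
    ← Matrix.mul_kronecker_mul, one_mul, mul_one, Matrix.kronecker_smul]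
  rw [← Finset.smul_sum, smul_smul, ← smul_sub, smul_smul, ← Finset.sum_sub_distrib]
  congr 1
  · norm_num
  · refine Finset.sum_congr rfl fun μ _ => ?_
    ext p q
    simp [Matrix.kroneckerMap_apply]
    ring

lemma trace_gamma (γ : Fin 4 → Matrix (Fin 4) (Fin 4) ℂ)
    (hγC : ∀ μ ν, γ μ * γ ν + γ ν * γ μ =
      if μ = ν then (2 : ℂ) • (1 : Matrix (Fin 4) (Fin 4) ℂ) else 0) (μ ν : Fin 4) :
    (γ μ * γ ν).trace = if μ = ν then 4 else 0 := by
  have h := congrArg Matrix.trace (hγC μ ν)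
  rw [Matrix.trace_add, Matrix.trace_mul_comm (γ ν)] at h
  split_ifs at h ⊢
  · rw [Matrix.trace_smul, Matrix.trace_one] at h
    simp at h
    linear_combination h / 2
  · simp at h
    exact h

lemma frob_eq (hNt : 3 ≤ Nt) (hNs : 3 ≤ Ns) (m0 : ℝ)
    (γ : Fin 4 → Matrix (Fin 4) (Fin 4) ℂ)
    (hγH : ∀ μ, (γ μ)ᴴ = γ μ)
    (hγC : ∀ μ ν, γ μ * γ ν + γ ν * γ μ =
      if μ = ν then (2 : ℂ) • (1 : Matrix (Fin 4) (Fin 4) ℂ) else 0)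
    (hU : ∀ μ x, U μ x ∈ Matrix.unitaryGroup (Fin 3) ℂ) :
    frobSq ((wilsonDirac m0 γ U)ᴴ * wilsonDirac m0 γ U -
        wilsonDirac m0 γ U * (wilsonDirac m0 γ U)ᴴ) =
    ∑ ν, ∑ μ, 4 * (2 * (Fintype.card (Site Nt Ns × Fin 3) : ℝ) - 2 * gg U μ ν) := by
  have ht : ∀ M : Matrix (Fin 4 × (Site Nt Ns × Fin 3)) (Fin 4 × (Site Nt Ns × Fin 3)) ℂ,
      (M.submatrix reord reord).trace = M.trace := by
    intro M
    exact Equiv.sum_comp reord (fun i => M i i)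
  rw [comm_eq U m0 γ hγH, frobSq, Matrix.conjTranspose_submatrix, Matrix.submatrix_mul_equiv, ht]
  have h1 : (((-1/2 : ℂ) • ∑ ν, γ ν ⊗ₖ (∑ i, XX U ν i))ᴴ *
      ((-1/2 : ℂ) • ∑ ν, γ ν ⊗ₖ (∑ i, XX U ν i))).trace =
      ∑ ν, ∑ i, ((XX U ν i)ᴴ * XX U ν i).trace := by
    rw [Matrix.conjTranspose_smul, Matrix.smul_mul, Matrix.mul_smul, smul_smul, Matrix.trace_smul,
      Matrix.conjTranspose_sum, Finset.sum_mul, Matrix.trace_sum, Finset.smul_sum]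
    refine Finset.sum_congr rfl fun ν _ => ?_
    rw [← trace_WW U hNt hNs hU, Finset.mul_sum, Matrix.trace_sum, Finset.sum_eq_single ν]
    · rw [Matrix.conjTranspose_kronecker, ← Matrix.mul_kronecker_mul, Matrix.trace_kronecker, hγH,
        trace_gamma γ hγC]
      simp
      ring
    · intro ν' _ hν
      rw [Matrix.conjTranspose_kronecker, ← Matrix.mul_kronecker_mul, Matrix.trace_kronecker, hγH,
        trace_gamma γ hγC, if_neg hν.symm, zero_mul]
    · simp
  rw [h1, Complex.re_sum]
  refine Finset.sum_congr rfl fun ν _ => ?_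
  rw [Complex.re_sum]
  simp only [trace_XX U hU]
  rw [Fintype.sum_prod_type]
  refine Finset.sum_congr rfl fun μ _ => ?_
  simp
  ring

end

/-- with `N_Q = 6·|L|` the total number of plaquettes and `Q_avg` the average
plaquette value, `‖D_Wᴴ D_W - D_W D_Wᴴ‖_F² = 16·N_Q·(3 - Q_avg)`. -/
theorem wilson_nonnormality_eq_avg_plaquette {Nt Ns : ℕ} [NeZero Nt] [NeZero Ns]
    (hNt : 3 ≤ Nt) (hNs : 3 ≤ Ns) (m0 : ℝ)
    (γ : Fin 4 → Matrix (Fin 4) (Fin 4) ℂ)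
    (hγH : ∀ μ, (γ μ)ᴴ = γ μ)
    (hγC : ∀ μ ν, γ μ * γ ν + γ ν * γ μ =
      if μ = ν then (2 : ℂ) • (1 : Matrix (Fin 4) (Fin 4) ℂ) else 0)
    (U : Fin 4 → Site Nt Ns → Matrix (Fin 3) (Fin 3) ℂ)
    (hU : ∀ μ x, U μ x ∈ Matrix.unitaryGroup (Fin 3) ℂ)
    (NQ : ℝ) (hNQ : NQ = 6 * (Fintype.card (Site Nt Ns) : ℝ))
    (Qavg : ℝ)
    (hQavg : Qavg = NQ⁻¹ * ∑ x : Site Nt Ns, ∑ μ : Fin 4,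
      ∑ ν ∈ Finset.univ.filter (fun ν => μ < ν),
        (Matrix.trace (plaquette U μ ν x)).re) :
    frobSq ((wilsonDirac m0 γ U)ᴴ * wilsonDirac m0 γ U -
        wilsonDirac m0 γ U * (wilsonDirac m0 γ U)ᴴ) =
      16 * NQ * (3 - Qavg) := by
  rw [frob_eq U hNt hNs m0 γ hγH hγC hU]
  have hpos : (0 : ℝ) < (Fintype.card (Site Nt Ns) : ℝ) := by
    exact_mod_cast Fintype.card_pos
  have hNQ0 : NQ ≠ 0 := by rw [hNQ]; positivity
  have hc : (Fintype.card (Site Nt Ns × Fin 3) : ℝ) = 3 * (Fintype.card (Site Nt Ns) : ℝ) := by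
    rw [Fintype.card_prod, Fintype.card_fin]; push_cast; ring
  have hS : ∑ x : Site Nt Ns, ∑ μ : Fin 4,
      ∑ ν ∈ Finset.univ.filter (fun ν => μ < ν), (Matrix.trace (plaquette U μ ν x)).re =
      ∑ μ : Fin 4, ∑ ν ∈ Finset.univ.filter (fun ν => μ < ν), gg U μ ν := by
    rw [Finset.sum_comm]
    refine Finset.sum_congr rfl fun μ _ => ?_
    rw [Finset.sum_comm]
    exact Finset.sum_congr rfl fun ν _ => (gg_eq U μ ν).symm
  have hQ : NQ * Qavg = ∑ μ : Fin 4, ∑ ν ∈ Finset.univ.filter (fun ν => μ < ν), gg U μ ν := by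
    rw [hQavg, hS, mul_inv_cancel_left₀ hNQ0]
  rw [mul_assoc, mul_sub, hQ, hNQ]
  simp only [Finset.sum_filter, Fin.sum_univ_four, gg_self U hU, hc]
  rw [gg_symm U 1 0, gg_symm U 2 0, gg_symm U 3 0, gg_symm U 2 1, gg_symm U 3 1, gg_symm U 3 2]
  simp [Fin.lt_def]
  ring
end
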